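/- Fundamental gap of the Dirichlet Laplacian in the form of Yu–Zhong and Smits (Corollary 3.5): Let Ω ⊂ ℝⁿ (n ≥ 2) be an open bounded convex set with smooth boundary, of diameter diam(Ω). Let λ₁(2,Ω) and λ₂(2,Ω) be the first and second Dirichlet eigenvalues of the Laplacian on Ω, with L²-normalized eigenfunctions u₁ (positive, log-concave) and u₂ (orthogonal to u₁ in L²(Ω)). Then λ₂(2,Ω) − λ₁(2,Ω) ≥ π² / diam(Ω)². -/

import Mathlib

open MeasureTheory Real Filter
open scoped RealInnerProductSpace

/-- The first Dirichlet eigenvalue of the Laplacian on `Ω`, defined as the infimum of the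
Rayleigh quotients over smooth nontrivial functions compactly supported in `Ω`. -/
noncomputable def lambda1 (n : ℕ) (Ω : Set (EuclideanSpace ℝ (Fin n))) : ℝ :=
  sInf { r : ℝ | ∃ u : EuclideanSpace ℝ (Fin n) → ℝ,
    ContDiff ℝ (⊤ : ℕ∞) u ∧ HasCompactSupport u ∧ tsupport u ⊆ Ω ∧ u ≠ 0 ∧
    r = (∫ x in Ω, ‖gradient u x‖ ^ 2) / (∫ x in Ω, |u x| ^ 2) }

/-- A Wirtinger inequality with log-convex weight `exp (-φ)`. -/
theorem wirtinger_exp_weight {a b κ : ℝ} (hab : a ≤ b) (hκ : 0 < κ) (hκab : κ * (b - a) < π)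
    {φ φ' φ'' H H' : ℝ → ℝ}
    (hφ : ∀ x ∈ Set.Icc a b, HasDerivAt φ (φ' x) x)
    (hφ' : ∀ x ∈ Set.Icc a b, HasDerivAt φ' (φ'' x) x)
    (hφ''c : ContinuousOn φ'' (Set.Icc a b)) (hφ''n : ∀ x ∈ Set.Icc a b, φ'' x ≤ 0)
    (hH : ∀ x ∈ Set.Icc a b, HasDerivAt H (H' x) x)
    (hH'c : ContinuousOn H' (Set.Icc a b)) (ha : H a = 0) (hb : H b = 0) :
    κ ^ 2 * ∫ x in a..b, exp (-φ x) * H x ^ 2 ≤ ∫ x in a..b, exp (-φ x) * H' x ^ 2 := by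
  have hφc : ContinuousOn φ (Set.Icc a b) := fun x hx => (hφ x hx).continuousAt.continuousWithinAt
  have hφ'c : ContinuousOn φ' (Set.Icc a b) := fun x hx => (hφ' x hx).continuousAt.continuousWithinAt
  have hHc : ContinuousOn H (Set.Icc a b) := fun x hx => (hH x hx).continuousAt.continuousWithinAt
  set c : ℝ → ℝ := fun x => -κ * tan (κ * (x - (a + b) / 2)) with hc
  have hcos : ∀ x ∈ Set.Icc a b, cos (κ * (x - (a + b) / 2)) ≠ 0 := by
    intro x hx
    apply ne_of_gt
    apply cos_pos_of_mem_Ioo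
    constructor <;> nlinarith [hx.1, hx.2]
  have hcd : ∀ x ∈ Set.Icc a b, HasDerivAt c (-κ ^ 2 - c x ^ 2) x := by
    intro x hx
    have h1 : HasDerivAt (fun x => κ * (x - (a + b) / 2)) (κ * 1) x :=
      ((hasDerivAt_id x).sub_const _).const_mul κ
    have h2 := ((hasDerivAt_tan (hcos x hx)).comp x h1).const_mul (-κ)
    refine h2.congr_deriv ?_
    have h3 := hcos x hx
    have h4 : 1 / cos (κ * (x - (a + b) / 2)) ^ 2 = 1 + tan (κ * (x - (a + b) / 2)) ^ 2 := by
      rw [← inv_one_add_tan_sq h3, one_div, inv_inv]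
    simp only [hc]
    rw [h4]
    ring
  have hcc : ContinuousOn c (Set.Icc a b) := fun x hx => (hcd x hx).continuousAt.continuousWithinAt
  set A : ℝ → ℝ := fun x => φ' x / 2 + c x with hA
  have hAd : ∀ x ∈ Set.Icc a b, HasDerivAt A (φ'' x / 2 + (-κ ^ 2 - c x ^ 2)) x := fun x hx =>
    ((hφ' x hx).div_const 2).add (hcd x hx)
  set G' : ℝ → ℝ := fun x => (exp (-φ x) * (-φ' x)) * (A x * H x ^ 2) +
    exp (-φ x) * ((φ'' x / 2 + (-κ ^ 2 - c x ^ 2)) * H x ^ 2 + A x * (2 * H x * H' x)) with hG'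
  have hGd : ∀ x ∈ Set.Icc a b, HasDerivAt (fun x => exp (-φ x) * (A x * H x ^ 2)) (G' x) x := by
    intro x hx
    have := ((hφ x hx).neg.exp).mul ((hAd x hx).mul ((hH x hx).pow 2))
    refine this.congr_deriv ?_
    simp [hG']
  have hG'c : ContinuousOn G' (Set.Icc a b) := by
    have : ContinuousOn A (Set.Icc a b) :=
      fun x hx => (hAd x hx).continuousAt.continuousWithinAt
    fun_prop
  have hu : Set.uIcc a b = Set.Icc a b := Set.uIcc_of_le hab
  have hFTC : ∫ x in a..b, G' x = 0 := by
    rw [intervalIntegral.integral_eq_sub_of_hasDerivAt (f := fun x => exp (-φ x) * (A x * H x ^ 2))]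
    · simp [ha, hb]
    · rw [hu]; exact hGd
    · exact ContinuousOn.intervalIntegrable (by rwa [hu])
  have hi1 : IntervalIntegrable (fun x => κ ^ 2 * (exp (-φ x) * H x ^ 2)) volume a b :=
    ContinuousOn.intervalIntegrable (by rw [hu]; fun_prop)
  have hi2 : IntervalIntegrable (fun x => exp (-φ x) * H' x ^ 2) volume a b :=
    ContinuousOn.intervalIntegrable (by rw [hu]; fun_prop)
  have hi3 : IntervalIntegrable G' volume a b := ContinuousOn.intervalIntegrable (by rwa [hu])
  rw [← intervalIntegral.integral_const_mul, ← add_zero (∫ x in a..b, κ ^ 2 * _), ← hFTC,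
    ← intervalIntegral.integral_add hi1 hi3]
  refine intervalIntegral.integral_mono_on hab (hi1.add hi3) hi2 fun x hx => ?_
  have key : exp (-φ x) * H' x ^ 2 - (κ ^ 2 * (exp (-φ x) * H x ^ 2) + G' x) =
      exp (-φ x) * ((H' x - A x * H x) ^ 2 + H x ^ 2 * (φ' x ^ 2 / 4 - φ'' x / 2)) := by
    simp only [hG', hA]; ring
  have : 0 ≤ exp (-φ x) * ((H' x - A x * H x) ^ 2 + H x ^ 2 * (φ' x ^ 2 / 4 - φ'' x / 2)) := by
    have := hφ''n x hx
    have : 0 ≤ φ' x ^ 2 / 4 - φ'' x / 2 := by nlinarith [sq_nonneg (φ' x)]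
    positivity
  linarith

/-- One-dimensional Poincaré inequality for a smooth log-concave weight. -/
theorem poincare_exp_weight {a b κ : ℝ} (hab : a ≤ b) (hκ : 0 < κ) (hκab : κ * (b - a) < π)
    {φ φ' φ'' f f' : ℝ → ℝ}
    (hφ : ∀ x ∈ Set.Icc a b, HasDerivAt φ (φ' x) x)
    (hφ' : ∀ x ∈ Set.Icc a b, HasDerivAt φ' (φ'' x) x)
    (hφ''c : ContinuousOn φ'' (Set.Icc a b)) (hφ''n : ∀ x ∈ Set.Icc a b, φ'' x ≤ 0)
    (hφc : Continuous φ)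
    (hf : ∀ x, HasDerivAt f (f' x) x) (hf' : Continuous f')
    (hmean : ∫ x in a..b, exp (φ x) * f x = 0) :
    κ ^ 2 * ∫ x in a..b, exp (φ x) * f x ^ 2 ≤ ∫ x in a..b, exp (φ x) * f' x ^ 2 := by
  have hfc : Continuous f := continuous_iff_continuousAt.2 fun x => (hf x).continuousAt
  set g : ℝ → ℝ := fun x => exp (φ x) * f x with hg
  have hgc : Continuous g := by fun_prop
  set H : ℝ → ℝ := fun x => ∫ t in a..x, g t with hHdef
  have hH : ∀ x, HasDerivAt H (g x) x := fun x =>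
    intervalIntegral.integral_hasDerivAt_right (hgc.intervalIntegrable _ _)
      (hgc.stronglyMeasurableAtFilter _ _) hgc.continuousAt
  have hHc : Continuous H := continuous_iff_continuousAt.2 fun x => (hH x).continuousAt
  have ha : H a = 0 := by simp [hHdef]
  have hb : H b = 0 := hmean
  have hw := wirtinger_exp_weight hab hκ hκab hφ hφ' hφ''c hφ''n (fun x _ => hH x)
    hgc.continuousOn ha hb
  have e1 : ∫ x in a..b, exp (-φ x) * g x ^ 2 = ∫ x in a..b, exp (φ x) * f x ^ 2 := by
    congr 1; ext x
    have : exp (-φ x) * exp (φ x) = 1 := by rw [← exp_add]; simp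
    simp only [hg]
    linear_combination (exp (φ x) * f x ^ 2) * this
  have e2 : ∫ x in a..b, exp (φ x) * f x ^ 2 = - ∫ x in a..b, H x * f' x := by
    have h := intervalIntegral.integral_mul_deriv_eq_deriv_mul (a := a) (b := b)
      (u := H) (v := f) (u' := g) (v' := f') (fun x _ => hH x) (fun x _ => hf x)
      (hgc.intervalIntegrable _ _) (hf'.intervalIntegrable _ _)
    rw [h, ha, hb]
    simp only [hg]; simp
    congr 1; ext x; ring
  have e3 : -(2 * κ ^ 2 * ∫ x in a..b, H x * f' x) ≤
      κ ^ 2 * (κ ^ 2 * ∫ x in a..b, exp (-φ x) * H x ^ 2) + ∫ x in a..b, exp (φ x) * f' x ^ 2 := by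
    rw [← intervalIntegral.integral_const_mul, ← intervalIntegral.integral_const_mul,
      ← intervalIntegral.integral_const_mul, ← intervalIntegral.integral_neg,
      ← intervalIntegral.integral_add]
    · refine intervalIntegral.integral_mono_on hab ?_ ?_ fun x _ => ?_
      · exact Continuous.intervalIntegrable (by fun_prop) _ _
      · exact Continuous.intervalIntegrable (by fun_prop) _ _
      · have h1 : exp (-φ x) * exp (φ x) = 1 := by rw [← exp_add]; simp
        have h2 : 0 ≤ exp (-φ x) * (κ ^ 2 * H x + exp (φ x) * f' x) ^ 2 := by positivity
        have h3 : exp (-φ x) * (κ ^ 2 * H x + exp (φ x) * f' x) ^ 2 =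
          κ ^ 2 * (κ ^ 2 * (exp (-φ x) * H x ^ 2)) + exp (φ x) * f' x ^ 2
            + 2 * κ ^ 2 * (H x * f' x) := by
          linear_combination (2 * κ ^ 2 * (H x * f' x) + exp (φ x) * f' x ^ 2) * h1
        linarith
    · exact Continuous.intervalIntegrable (by fun_prop) _ _
    · exact Continuous.intervalIntegrable (by fun_prop) _ _
  rw [e1] at hw
  have hk : 0 < κ ^ 2 := by positivity
  nlinarith

theorem hasDerivAt_average {g : ℝ → ℝ} (hg : Continuous g) (h x : ℝ) :
    HasDerivAt (fun x => h⁻¹ * ∫ t in x..x + h, g t) (h⁻¹ * (g (x + h) - g x)) x := by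
  have h1 : HasDerivAt (fun x => ∫ t in (0 : ℝ)..x, g t) (g x) x :=
    intervalIntegral.integral_hasDerivAt_right (hg.intervalIntegrable _ _)
      (hg.stronglyMeasurableAtFilter _ _) hg.continuousAt
  have h2 : HasDerivAt (fun x => ∫ t in (0 : ℝ)..x + h, g t) (g (x + h)) x := by
    have : HasDerivAt (fun x => ∫ t in (0 : ℝ)..x, g t) (g (x + h)) (x + h) :=
      intervalIntegral.integral_hasDerivAt_right (hg.intervalIntegrable _ _)
        (hg.stronglyMeasurableAtFilter _ _) hg.continuousAt
    exact this.comp_add_const x h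
  refine ((h2.sub h1).const_mul h⁻¹).congr_of_eventuallyEq (Eventually.of_forall fun y => ?_)
  simp only [Pi.sub_apply]
  rw [intervalIntegral.integral_interval_sub_left (hg.intervalIntegrable _ _)
    (hg.intervalIntegrable _ _)]

theorem abs_average_sub_le {g : ℝ → ℝ} (hg : Continuous g) {h x c ω : ℝ} (hh : 0 < h)
    (hω : ∀ y ∈ Set.Icc x (x + h), |g y - c| ≤ ω) :
    |h⁻¹ * (∫ t in x..x + h, g t) - c| ≤ ω := by
  have e : h⁻¹ * (∫ t in x..x + h, g t) - c = h⁻¹ * ∫ t in x..x + h, (g t - c) := by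
    rw [intervalIntegral.integral_sub (hg.intervalIntegrable _ _) (by simp)]
    simp
    field_simp
  have b : ‖∫ t in x..x + h, (g t - c)‖ ≤ ω * |x + h - x| :=
    intervalIntegral.norm_integral_le_of_norm_le_const fun t ht => by
      rw [Set.uIoc_of_le (by linarith)] at ht
      exact hω t ⟨ht.1.le, ht.2⟩
  rw [e, abs_mul, abs_of_pos (inv_pos.2 hh)]
  rw [add_sub_cancel_left, abs_of_pos hh, norm_eq_abs] at b
  calc h⁻¹ * _ ≤ h⁻¹ * (ω * h) := by gcongr
    _ = ω := by field_simp

/-- A concave function can be approximated uniformly on a compact interval by `C²` functions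
that are concave there. -/
theorem exists_smooth_concave_approx {A B a b ω : ℝ} {φ : ℝ → ℝ} (hφ : ConcaveOn ℝ (Set.Ioo A B) φ)
    (hA : A < a) (hab : a ≤ b) (hB : b < B) (hω : 0 < ω) :
    ∃ ψ ψ' ψ'' : ℝ → ℝ, Continuous ψ ∧ (∀ x ∈ Set.Icc a b, HasDerivAt ψ (ψ' x) x) ∧
      (∀ x ∈ Set.Icc a b, HasDerivAt ψ' (ψ'' x) x) ∧ ContinuousOn ψ'' (Set.Icc a b) ∧
      (∀ x ∈ Set.Icc a b, ψ'' x ≤ 0) ∧ ∀ x ∈ Set.Icc a b, |ψ x - φ x| ≤ ω := by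
  set b' := (b + B) / 2 with hb'
  have hbb' : b < b' := by rw [hb']; linarith
  have hb'B : b' < B := by rw [hb']; linarith
  have hsub : Set.Icc a b' ⊆ Set.Ioo A B := fun x hx => ⟨hA.trans_le hx.1, hx.2.trans_lt hb'B⟩
  have hφc : ContinuousOn φ (Set.Icc a b') := (hφ.continuousOn isOpen_Ioo).mono hsub
  have hab' : a ≤ b' := hab.trans hbb'.le
  set g : ℝ → ℝ := Set.IccExtend hab' ((Set.Icc a b').domRestrict φ) with hg
  have hgc : Continuous g := (continuousOn_iff_continuous_domRestrict.1 hφc).Icc_extend'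
  have hgφ : ∀ x ∈ Set.Icc a b', g x = φ x := fun x hx => by
    rw [hg, Set.IccExtend_of_mem hab' _ hx]; rfl
  have huc := isCompact_Icc.uniformContinuousOn_of_continuous hφc
  obtain ⟨δ, hδ, hδω⟩ := Metric.uniformContinuousOn_iff_le.1 huc ω hω
  set h := min (δ / 2) ((b' - b) / 2) with hh
  have hh0 : 0 < h := lt_min (by linarith) (by linarith)
  have hhδ : 2 * h ≤ δ := by have := min_le_left (δ / 2) ((b' - b) / 2); linarith
  have hhb : b + 2 * h ≤ b' := by have := min_le_right (δ / 2) ((b' - b) / 2); linarith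
  set M : ℝ → ℝ := fun x => h⁻¹ * ∫ t in x..x + h, g t with hM
  have hMd : ∀ x, HasDerivAt M (h⁻¹ * (g (x + h) - g x)) x := hasDerivAt_average hgc h
  have hMc : Continuous M := continuous_iff_continuousAt.2 fun x => (hMd x).continuousAt
  have hNd := hasDerivAt_average hMc h
  refine ⟨fun x => h⁻¹ * ∫ t in x..x + h, M t, fun x => h⁻¹ * (M (x + h) - M x),
    fun x => h⁻¹ * (h⁻¹ * (g (x + h + h) - g (x + h)) - h⁻¹ * (g (x + h) - g x)),
    continuous_iff_continuousAt.2 fun x => (hNd x).continuousAt, fun x _ => hNd x,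
    fun x _ => ?_, ?_, fun x hx => ?_, fun x hx => ?_⟩
  · exact (((hMd (x + h)).comp_add_const x h).sub (hMd x)).const_mul _
  · fun_prop
  · have m0 : x ∈ Set.Icc a b' := ⟨hx.1, hx.2.trans hbb'.le⟩
    have m1 : x + h ∈ Set.Icc a b' := ⟨by linarith [hx.1], by linarith [hx.2]⟩
    have m2 : x + h + h ∈ Set.Icc a b' := ⟨by linarith [hx.1], by linarith [hx.2]⟩
    beta_reduce
    rw [hgφ _ m0, hgφ _ m1, hgφ _ m2]
    have := hφ.2 (hsub m0) (hsub m2) (show (0 : ℝ) ≤ 1 / 2 by norm_num)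
      (show (0 : ℝ) ≤ 1 / 2 by norm_num) (by norm_num)
    have e : (1 / 2 : ℝ) • x + (1 / 2 : ℝ) • (x + h + h) = x + h := by
      simp only [smul_eq_mul]; ring
    rw [e] at this
    simp only [smul_eq_mul] at this
    rw [← mul_sub, ← mul_assoc]
    exact mul_nonpos_of_nonneg_of_nonpos (by positivity) (by linarith)
  · refine abs_average_sub_le hMc hh0 fun y hy => abs_average_sub_le hgc hh0 fun z hz => ?_
    have mz : z ∈ Set.Icc a b' := ⟨by linarith [hx.1, hy.1, hz.1], by linarith [hx.2, hy.2, hz.2]⟩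
    have m0 : x ∈ Set.Icc a b' := ⟨hx.1, hx.2.trans hbb'.le⟩
    rw [hgφ z mz]
    refine hδω z mz x m0 ?_
    rw [Real.dist_eq, abs_le]
    constructor <;> linarith [hy.1, hy.2, hz.1, hz.2]

theorem poincare_concave_weight {A B a b κ : ℝ} {φ f f' : ℝ → ℝ} (hφ : ConcaveOn ℝ (Set.Ioo A B) φ)
    (hA : A < a) (hab : a < b) (hB : b < B) (hκ : 0 < κ) (hκab : κ * (b - a) < π)
    (hf : ∀ x, HasDerivAt f (f' x) x) (hf' : Continuous f') :
    κ ^ 2 * ((∫ x in a..b, exp (φ x)) * (∫ x in a..b, exp (φ x) * f x ^ 2)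
        - (∫ x in a..b, exp (φ x) * f x) ^ 2) ≤
      (∫ x in a..b, exp (φ x)) * ∫ x in a..b, exp (φ x) * f' x ^ 2 := by
  have hfc : Continuous f := continuous_iff_continuousAt.2 fun x => (hf x).continuousAt
  have hu : Set.uIcc a b = Set.Icc a b := Set.uIcc_of_le hab.le
  have hφc : ContinuousOn φ (Set.uIcc a b) := (hφ.continuousOn isOpen_Ioo).mono
    (by rw [hu]; exact fun x hx => ⟨hA.trans_le hx.1, hx.2.trans_lt hB⟩)
  have hm : 0 ≤ ∫ x in a..b, exp (φ x) :=
    intervalIntegral.integral_nonneg hab.le fun x _ => (exp_pos _).le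
  have key : ∀ ω > 0, κ ^ 2 * ((∫ x in a..b, exp (φ x)) * (∫ x in a..b, exp (φ x) * f x ^ 2)
        - (∫ x in a..b, exp (φ x) * f x) ^ 2) ≤
      exp (2 * ω) * ((∫ x in a..b, exp (φ x)) * ∫ x in a..b, exp (φ x) * f' x ^ 2) := by
    intro ω hω
    obtain ⟨ψ, ψ', ψ'', hψc, h1, h2, h3, h4, h5⟩ :=
      exists_smooth_concave_approx hφ hA hab.le hB hω
    have hpos : 0 < ∫ x in a..b, exp (ψ x) :=
      intervalIntegral.intervalIntegral_pos_of_pos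
        (Continuous.intervalIntegrable (by fun_prop) _ _) (fun x => exp_pos _) hab
    set c := (∫ x in a..b, exp (ψ x) * f x) / ∫ x in a..b, exp (ψ x) with hc
    have hmean : ∫ x in a..b, exp (ψ x) * (f x - c) = 0 := by
      simp only [mul_sub]
      rw [intervalIntegral.integral_sub (Continuous.intervalIntegrable (by fun_prop) _ _)
        (Continuous.intervalIntegrable (by fun_prop) _ _), intervalIntegral.integral_mul_const, hc]
      field_simp
      ring
    have hP := poincare_exp_weight hab.le hκ hκab h1 h2 h3 h4 hψc
      (fun x => (hf x).sub_const c) hf' hmean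
    have l1 : ∫ x in a..b, exp (φ x) * (f x - c) ^ 2 ≤
        exp ω * ∫ x in a..b, exp (ψ x) * (f x - c) ^ 2 := by
      rw [← intervalIntegral.integral_const_mul]
      refine intervalIntegral.integral_mono_on hab.le
        (ContinuousOn.intervalIntegrable (by fun_prop)) 
        (Continuous.intervalIntegrable (by fun_prop) _ _) fun x hx => ?_
      rw [← mul_assoc, ← exp_add]
      gcongr
      linarith [(abs_le.1 (h5 x hx)).1]
    have l2 : ∫ x in a..b, exp (ψ x) * f' x ^ 2 ≤ exp ω * ∫ x in a..b, exp (φ x) * f' x ^ 2 := by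
      rw [← intervalIntegral.integral_const_mul]
      refine intervalIntegral.integral_mono_on hab.le
        (Continuous.intervalIntegrable (by fun_prop) _ _)
        (ContinuousOn.intervalIntegrable (by fun_prop)) fun x hx => ?_
      rw [← mul_assoc, ← exp_add]
      gcongr
      linarith [(abs_le.1 (h5 x hx)).2]
    have l3 : ∫ x in a..b, exp (φ x) * (f x - c) ^ 2 = (∫ x in a..b, exp (φ x) * f x ^ 2)
        - 2 * c * (∫ x in a..b, exp (φ x) * f x) + c ^ 2 * ∫ x in a..b, exp (φ x) := by
      rw [← intervalIntegral.integral_const_mul, ← intervalIntegral.integral_const_mul,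
        ← intervalIntegral.integral_sub, ← intervalIntegral.integral_add]
      · congr 1; ext x; ring
      all_goals exact ContinuousOn.intervalIntegrable (by fun_prop)
    have l4 : κ ^ 2 * ∫ x in a..b, exp (φ x) * (f x - c) ^ 2 ≤
        exp (2 * ω) * ∫ x in a..b, exp (φ x) * f' x ^ 2 := by
      calc _ ≤ κ ^ 2 * (exp ω * ∫ x in a..b, exp (ψ x) * (f x - c) ^ 2) := by gcongr
        _ = exp ω * (κ ^ 2 * ∫ x in a..b, exp (ψ x) * (f x - c) ^ 2) := by ring
        _ ≤ exp ω * (exp ω * ∫ x in a..b, exp (φ x) * f' x ^ 2) :=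
          mul_le_mul_of_nonneg_left (hP.trans l2) (exp_pos _).le
        _ = _ := by rw [← mul_assoc, ← exp_add, two_mul]
    have l5 := mul_le_mul_of_nonneg_left l4 hm
    rw [l3] at l5
    nlinarith [mul_nonneg (sq_nonneg κ) (sq_nonneg ((∫ x in a..b, exp (φ x) * f x)
      - c * ∫ x in a..b, exp (φ x)))]
  have ht : Tendsto (fun ω => exp (2 * ω) * ((∫ x in a..b, exp (φ x)) *
      ∫ x in a..b, exp (φ x) * f' x ^ 2)) (nhdsWithin 0 (Set.Ioi 0))
      (nhds (exp (2 * 0) * ((∫ x in a..b, exp (φ x)) *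
      ∫ x in a..b, exp (φ x) * f' x ^ 2))) :=
    (Continuous.tendsto (by fun_prop) _).mono_left nhdsWithin_le_nhds
  rw [mul_zero, exp_zero, one_mul] at ht
  exact ge_of_tendsto ht (eventually_nhdsWithin_of_forall fun ω hω => key ω hω)

/-- Bounded measurable log-concave weights whose support has diameter at most `D`. -/
structure IsLogConcaveWeight {E : Type*} [NormedAddCommGroup E] [NormedSpace ℝ E]
    [MeasurableSpace E] (D : ℝ) (ρ : E → ℝ) : Prop where
  nonneg : ∀ x, 0 ≤ ρ x
  measurable : Measurable ρ
  bounded : ∃ M, ∀ x, ρ x ≤ M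
  concaveOn_log : ConcaveOn ℝ {x | 0 < ρ x} fun x => log (ρ x)
  dist_le : ∀ x y, 0 < ρ x → 0 < ρ y → dist x y ≤ D

/-- The variance form of the weighted Poincaré inequality with constant `κ²`, for all log-concave
weights with support of diameter at most `D`. -/
def HasLogConcavePoincare {E : Type*} [NormedAddCommGroup E] [NormedSpace ℝ E]
    [MeasurableSpace E] (μ : Measure E) (κ D : ℝ) : Prop :=
  ∀ ρ : E → ℝ, IsLogConcaveWeight D ρ → ∀ f : E → ℝ, ContDiff ℝ 1 f → HasCompactSupport f →
    κ ^ 2 * ((∫ x, ρ x ∂μ) * (∫ x, ρ x * f x ^ 2 ∂μ) - (∫ x, ρ x * f x ∂μ) ^ 2) ≤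
      (∫ x, ρ x ∂μ) * ∫ x, ρ x * ‖fderiv ℝ f x‖ ^ 2 ∂μ

namespace IsLogConcaveWeight

section
variable {E : Type*} [NormedAddCommGroup E] [NormedSpace ℝ E] [MeasurableSpace E]
  {D : ℝ} {ρ : E → ℝ}

theorem eq_zero_of_not_pos (h : IsLogConcaveWeight D ρ) {x : E} (hx : ¬ 0 < ρ x) : ρ x = 0 :=
  le_antisymm (not_lt.1 hx) (h.nonneg x)

theorem isBounded (h : IsLogConcaveWeight D ρ) : Bornology.IsBounded {x | 0 < ρ x} :=
  Metric.isBounded_iff.2 ⟨D, fun x hx y hy => h.dist_le x y hx hy⟩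

theorem integrable [FiniteDimensional ℝ E] [BorelSpace E] {μ : Measure E}
    [IsFiniteMeasureOnCompacts μ] (h : IsLogConcaveWeight D ρ) : Integrable ρ μ := by
  obtain ⟨M, hM⟩ := h.bounded
  have : ProperSpace E := FiniteDimensional.proper ℝ E
  have hs : Function.support ρ ⊆ {x | 0 < ρ x} := fun x hx =>
    lt_of_le_of_ne (h.nonneg x) (Ne.symm hx)
  rw [← integrableOn_iff_integrable_of_support_subset hs]
  refine Measure.integrableOn_of_bounded (M := M) h.isBounded.measure_lt_top.ne
    h.measurable.aestronglyMeasurable (Eventually.of_forall fun x => ?_)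
  rw [norm_of_nonneg (h.nonneg x)]
  exact hM x

theorem integrable_mul [FiniteDimensional ℝ E] [BorelSpace E] {μ : Measure E}
    [IsFiniteMeasureOnCompacts μ] (h : IsLogConcaveWeight D ρ) {g : E → ℝ} (hg : Continuous g) :
    Integrable (fun x => ρ x * g x) μ := by
  have : ProperSpace E := FiniteDimensional.proper ℝ E
  obtain ⟨C, hC⟩ := h.isBounded.isCompact_closure.exists_bound_of_continuousOn hg.continuousOn
  refine Integrable.mono' (h.integrable.mul_const C)
    (h.measurable.mul hg.measurable).aestronglyMeasurable (Eventually.of_forall fun x => ?_)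
  rw [norm_mul, norm_of_nonneg (h.nonneg x)]
  by_cases hx : 0 < ρ x
  · exact mul_le_mul_of_nonneg_left (hC x (subset_closure hx)) (h.nonneg x)
  · simp [h.eq_zero_of_not_pos hx]

end

theorem integral_mul_eq {D : ℝ} {ρ : ℝ → ℝ} (h : IsLogConcaveWeight D ρ)
   {A B : ℝ} (hAB : A ≤ B) (hs : {x | 0 < ρ x} ⊆ Set.Icc A B) (g : ℝ → ℝ) :
    ∫ x, ρ x * g x = ∫ x in A..B, ρ x * g x := by
  rw [intervalIntegral.integral_of_le hAB, ← integral_Icc_eq_integral_Ioc]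
  refine (setIntegral_eq_integral_of_forall_compl_eq_zero fun x hx => ?_).symm
  rw [h.eq_zero_of_not_pos fun h => hx (hs h), zero_mul]

end IsLogConcaveWeight

theorem tendsto_integral_shrink {A B : ℝ} {g : ℝ → ℝ} (hg : Integrable g) :
    Tendsto (fun t => ∫ x in A + t..B - t, g x) (nhdsWithin 0 (Set.Ioi 0))
      (nhds (∫ x in A..B, g x)) := by
  have hc : Continuous fun b => ∫ x in (0 : ℝ)..b, g x :=
    intervalIntegral.continuous_primitive (fun a b => hg.intervalIntegrable) 0
  have e : (fun t => ∫ x in A + t..B - t, g x) =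
      fun t => (∫ x in (0 : ℝ)..B - t, g x) - ∫ x in (0 : ℝ)..A + t, g x := by
    ext t
    rw [intervalIntegral.integral_interval_sub_left hg.intervalIntegrable hg.intervalIntegrable]
  have : Continuous (fun t => ∫ x in A + t..B - t, g x) := by
    rw [e]
    exact (hc.comp (by fun_prop : Continuous fun t => B - t)).sub
      (hc.comp (by fun_prop : Continuous fun t => A + t))
  have := this.tendsto 0
  simp only [add_zero, sub_zero] at this
  exact this.mono_left nhdsWithin_le_nhds

theorem hasLogConcavePoincare_real {κ D : ℝ} (hκ : 0 < κ) (hκD : κ * D < π) :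
    HasLogConcavePoincare (volume : Measure ℝ) κ D := by
  intro ρ h f hf _
  set s := {x | 0 < ρ x} with hs
  by_cases hne : s.Nonempty
  swap
  · have : ρ = 0 := funext fun x => h.eq_zero_of_not_pos fun hx => hne ⟨x, hx⟩
    simp [this]
  have hbb := h.isBounded.bddBelow
  have hba := h.isBounded.bddAbove
  set A := sInf s
  set B := sSup s
  have hsAB : s ⊆ Set.Icc A B := fun x hx => ⟨csInf_le hbb hx, le_csSup hba hx⟩
  have hAB : A ≤ B := csInf_le_csSup hne hbb hba
  have hBA : B - A ≤ D := by
    have h1 : ∀ x ∈ s, x - D ≤ A := fun x hx => le_csInf hne fun y hy => by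
      have := h.dist_le x y hx hy
      rw [Real.dist_eq] at this
      linarith [le_abs_self (x - y)]
    have : B ≤ A + D := csSup_le hne fun x hx => by linarith [h1 x hx]
    linarith
  have hIoo : Set.Ioo A B ⊆ s := fun x hx => by
    obtain ⟨y, hy, hyx⟩ := exists_lt_of_csInf_lt hne hx.1
    obtain ⟨z, hz, hxz⟩ := exists_lt_of_lt_csSup hne hx.2
    exact h.concaveOn_log.1.ordConnected.out hy hz ⟨hyx.le, hxz.le⟩
  have hconc : ConcaveOn ℝ (Set.Ioo A B) fun x => log (ρ x) :=
    h.concaveOn_log.subset hIoo (convex_Ioo A B)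
  have hfd : ∀ x, HasDerivAt f (deriv f x) x := fun x =>
    (hf.differentiable one_ne_zero x).hasDerivAt
  have hf'c : Continuous (deriv f) := hf.continuous_deriv le_rfl
  have hnorm : ∀ x, ‖fderiv ℝ f x‖ ^ 2 = deriv f x ^ 2 := fun x => by
    rw [← norm_deriv_eq_norm_fderiv, norm_eq_abs, sq_abs]
  simp only [hnorm]
  have e0 : ∫ x, ρ x = ∫ x in A..B, ρ x := by
    simpa using h.integral_mul_eq hAB hsAB fun _ => 1
  rw [h.integral_mul_eq hAB hsAB f, h.integral_mul_eq hAB hsAB fun x => f x ^ 2,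
    h.integral_mul_eq hAB hsAB fun x => deriv f x ^ 2, e0]
  rcases hAB.eq_or_lt with hAB' | hAB'
  · simp [← hAB']
  have i0 : Integrable ρ := h.integrable
  have i1 : Integrable fun x => ρ x * f x := h.integrable_mul hf.continuous
  have i2 : Integrable fun x => ρ x * f x ^ 2 := h.integrable_mul (hf.continuous.pow 2)
  have i3 : Integrable fun x => ρ x * deriv f x ^ 2 := h.integrable_mul (hf'c.pow 2)
  have t0 := tendsto_integral_shrink (A := A) (B := B) i0
  have t1 := tendsto_integral_shrink (A := A) (B := B) i1
  have t2 := tendsto_integral_shrink (A := A) (B := B) i2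
  have t3 := tendsto_integral_shrink (A := A) (B := B) i3
  refine le_of_tendsto_of_tendsto (((t0.mul t2).sub (t1.pow 2)).const_mul (κ ^ 2)) (t0.mul t3) ?_
  have hev : ∀ᶠ t in nhdsWithin (0 : ℝ) (Set.Ioi 0), t ∈ Set.Ioo 0 ((B - A) / 2) :=
    Ioo_mem_nhdsGT (by linarith)
  filter_upwards [hev] with t ht
  have hlt : A + t < B - t := by linarith [ht.2]
  have := poincare_concave_weight hconc (a := A + t) (b := B - t) (κ := κ) (by linarith [ht.1]) hlt
    (by linarith [ht.1]) hκ (by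
      refine lt_of_le_of_lt ?_ hκD
      gcongr
      linarith [ht.1]) hfd hf'c
  have ec : ∀ g : ℝ → ℝ, ∫ x in A + t..B - t, exp (log (ρ x)) * g x =
      ∫ x in A + t..B - t, ρ x * g x := fun g =>
    intervalIntegral.integral_congr fun x hx => by
      rw [Set.uIcc_of_le hlt.le] at hx
      have : 0 < ρ x := hIoo ⟨by linarith [hx.1, ht.1], by linarith [hx.2, ht.1]⟩
      simp only [exp_log this]
  have ec0 := ec fun _ => 1
  simp only [mul_one] at ec0
  rw [ec f, ec fun x => f x ^ 2, ec fun x => deriv f x ^ 2, ec0] at this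
  exact this

namespace IsLogConcaveWeight

theorem concaveOn_log_of_rpow_mul_le {E : Type*} [AddCommGroup E] [Module ℝ E] {ρ : E → ℝ}
    (h : ∀ x y, 0 < ρ x → 0 < ρ y → ∀ a b : ℝ, 0 < a → 0 < b → a + b = 1 →
      ρ x ^ a * ρ y ^ b ≤ ρ (a • x + b • y)) :
    ConcaveOn ℝ {x | 0 < ρ x} fun x => log (ρ x) := by
  have hpos : ∀ x y, 0 < ρ x → 0 < ρ y → ∀ a b : ℝ, 0 < a → 0 < b → a + b = 1 →
      0 < ρ (a • x + b • y) := fun x y hx hy a b ha hb hab =>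
    lt_of_lt_of_le (by positivity) (h x y hx hy a b ha hb hab)
  refine concaveOn_iff_forall_pos.2 ⟨convex_iff_forall_pos.2 fun x hx y hy a b ha hb hab =>
    hpos x y hx hy a b ha hb hab, fun x hx y hy a b ha hb hab => ?_⟩
  have hx' : 0 < ρ x := hx
  have hy' : 0 < ρ y := hy
  have := log_le_log (by positivity) (h x y hx hy a b ha hb hab)
  rw [log_mul (by positivity) (by positivity), log_rpow hx', log_rpow hy'] at this
  simpa using this

section
variable {E : Type*} [NormedAddCommGroup E] [NormedSpace ℝ E] [MeasurableSpace E]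
  {D : ℝ} {ρ : E → ℝ}

theorem rpow_mul_le (h : IsLogConcaveWeight D ρ) {x y : E} (hx : 0 < ρ x) (hy : 0 < ρ y)
    {a b : ℝ} (ha : 0 ≤ a) (hb : 0 ≤ b) (hab : a + b = 1) :
    ρ x ^ a * ρ y ^ b ≤ ρ (a • x + b • y) := by
  have hz : 0 < ρ (a • x + b • y) := h.concaveOn_log.1 hx hy ha hb hab
  rw [← log_le_log_iff (by positivity) hz, log_mul (by positivity) (by positivity),
    log_rpow hx, log_rpow hy]
  simpa using h.concaveOn_log.2 hx hy ha hb hab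

theorem convex_superlevel (h : IsLogConcaveWeight D ρ) {τ : ℝ} (hτ : 0 < τ) :
    Convex ℝ {x | τ < ρ x} := by
  have e : {x | τ < ρ x} = {x ∈ {x | 0 < ρ x} | log τ < log (ρ x)} := by
    ext x
    refine ⟨fun hx => ⟨hτ.trans hx, log_lt_log hτ hx⟩, fun hx => ?_⟩
    exact (log_lt_log_iff hτ hx.1).1 hx.2
  rw [e]
  exact h.concaveOn_log.convex_gt _

theorem div_const (h : IsLogConcaveWeight D ρ) {c : ℝ} (hc : 0 < c) :
    IsLogConcaveWeight D fun x => ρ x / c where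
  nonneg x := div_nonneg (h.nonneg x) hc.le
  measurable := h.measurable.div_const c
  bounded := by
    obtain ⟨M, hM⟩ := h.bounded
    exact ⟨M / c, fun x => by gcongr; exact hM x⟩
  concaveOn_log := by
    have e : {x | 0 < ρ x / c} = {x | 0 < ρ x} := by
      ext x; simp [div_pos_iff_of_pos_right hc]
    rw [e]
    refine (h.concaveOn_log.sub (convexOn_const (log c) h.concaveOn_log.1)).congr fun x hx => ?_
    rw [log_div (ne_of_gt hx) hc.ne']
    rfl
  dist_le x y hx hy := h.dist_le x y ((div_pos_iff_of_pos_right hc).1 hx)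
    ((div_pos_iff_of_pos_right hc).1 hy)

end

end IsLogConcaveWeight

theorem volume_of_convex_real {s : Set ℝ} (hs : Convex ℝ s) (hb : Bornology.IsBounded s)
    (hne : s.Nonempty) : volume s = ENNReal.ofReal (sSup s - sInf s) := by
  have hbb := hb.bddBelow
  have hba := hb.bddAbove
  apply le_antisymm
  · rw [← Real.volume_Icc]
    exact measure_mono fun x hx => ⟨csInf_le hbb hx, le_csSup hba hx⟩
  · rw [← Real.volume_Ioo]
    refine measure_mono fun x hx => ?_
    obtain ⟨y, hy, hyx⟩ := exists_lt_of_csInf_lt hne hx.1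
    obtain ⟨z, hz, hxz⟩ := exists_lt_of_lt_csSup hne hx.2
    exact hs.ordConnected.out hy hz ⟨hyx.le, hxz.le⟩

/-- Brunn–Minkowski on the real line, for bounded convex sets. -/
theorem volume_convex_combination_le {s t u : Set ℝ} (hs : Convex ℝ s) (ht : Convex ℝ t)
    (hu : Convex ℝ u) (bs : Bornology.IsBounded s) (bt : Bornology.IsBounded t)
    (bu : Bornology.IsBounded u) (ns : s.Nonempty) (nt : t.Nonempty) {a b : ℝ} (ha : 0 < a)
    (hb : 0 < b) (h : ∀ x ∈ s, ∀ y ∈ t, a * x + b * y ∈ u) :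
    ENNReal.ofReal a * volume s + ENNReal.ofReal b * volume t ≤ volume u := by
  obtain ⟨x₀, hx₀⟩ := ns
  obtain ⟨y₀, hy₀⟩ := nt
  have hs1 := csInf_le_csSup ⟨x₀, hx₀⟩ bs.bddBelow bs.bddAbove
  have ht1 := csInf_le_csSup ⟨y₀, hy₀⟩ bt.bddBelow bt.bddAbove
  rw [volume_of_convex_real hs bs ⟨x₀, hx₀⟩, volume_of_convex_real ht bt ⟨y₀, hy₀⟩,
    volume_of_convex_real hu bu ⟨_, h x₀ hx₀ y₀ hy₀⟩, ← ENNReal.ofReal_mul ha.le,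
    ← ENNReal.ofReal_mul hb.le, ← ENNReal.ofReal_add (mul_nonneg ha.le (sub_nonneg.2 hs1))
      (mul_nonneg hb.le (sub_nonneg.2 ht1))]
  apply ENNReal.ofReal_le_ofReal
  have h1 : a * sSup s + b * sSup t ≤ sSup u := by
    have k1 : ∀ y ∈ t, sSup s ≤ (sSup u - b * y) / a := fun y hy => csSup_le ⟨x₀, hx₀⟩ fun x hx => by
      rw [le_div_iff₀ ha]
      linarith [le_csSup bu.bddAbove (h x hx y hy)]
    have k2 : sSup t ≤ (sSup u - a * sSup s) / b := csSup_le ⟨y₀, hy₀⟩ fun y hy => by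
      rw [le_div_iff₀ hb]
      linarith [(le_div_iff₀ ha).1 (k1 y hy)]
    linarith [(le_div_iff₀ hb).1 k2]
  have h2 : sInf u ≤ a * sInf s + b * sInf t := by
    have k1 : ∀ y ∈ t, (sInf u - b * y) / a ≤ sInf s := fun y hy => le_csInf ⟨x₀, hx₀⟩ fun x hx => by
      rw [div_le_iff₀ ha]
      linarith [csInf_le bu.bddBelow (h x hx y hy)]
    have k2 : (sInf u - a * sInf s) / b ≤ sInf t := le_csInf ⟨y₀, hy₀⟩ fun y hy => by
      rw [div_le_iff₀ hb]
      linarith [(div_le_iff₀ ha).1 (k1 y hy)]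
    linarith [(div_le_iff₀ hb).1 k2]
  linarith

theorem prekopa_normalized {D : ℝ} {f₀ f₁ g : ℝ → ℝ} (h₀ : IsLogConcaveWeight D f₀)
    (h₁ : IsLogConcaveWeight D f₁) (hg : IsLogConcaveWeight D g) {a b : ℝ} (ha : 0 < a)
    (hb : 0 < b) (hab : a + b = 1)
    (h : ∀ s t, 0 < f₀ s → 0 < f₁ t → f₀ s ^ a * f₁ t ^ b ≤ g (a * s + b * t))
    (s₀ : IsLUB (Set.range f₀) 1) (s₁ : IsLUB (Set.range f₁) 1) :
    a * (∫ x, f₀ x) + b * (∫ x, f₁ x) ≤ ∫ x, g x := by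
  have lv : ∀ {f : ℝ → ℝ}, IsLogConcaveWeight D f →
      ENNReal.ofReal (∫ x, f x) = ∫⁻ t in Set.Ioi 0, volume {x | t < f x} := fun {f} hf => by
    rw [ofReal_integral_eq_lintegral_ofReal hf.integrable (Eventually.of_forall hf.nonneg)]
    exact lintegral_eq_lintegral_meas_lt _ (Eventually.of_forall hf.nonneg) hf.measurable.aemeasurable
  have anti : ∀ f : ℝ → ℝ, Measurable fun t => volume {x | t < f x} := fun f =>
    Antitone.measurable fun t t' htt' => measure_mono fun x hx => lt_of_le_of_lt htt' hx
  have bdd : ∀ {f : ℝ → ℝ}, IsLogConcaveWeight D f → ∀ t > 0,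
      Bornology.IsBounded {x | t < f x} := fun hf t ht =>
    hf.isBounded.subset fun x hx => lt_trans ht hx
  have i₀ : 0 ≤ ∫ x, f₀ x := integral_nonneg h₀.nonneg
  have i₁ : 0 ≤ ∫ x, f₁ x := integral_nonneg h₁.nonneg
  rw [← ENNReal.ofReal_le_ofReal_iff (integral_nonneg hg.nonneg),
    ENNReal.ofReal_add (by positivity) (by positivity), ENNReal.ofReal_mul ha.le,
    ENNReal.ofReal_mul hb.le, lv h₀, lv h₁, lv hg,
    ← lintegral_const_mul _ (anti f₀), ← lintegral_const_mul _ (anti f₁),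
    ← lintegral_add_left ((anti f₀).const_mul _)]
  refine setLIntegral_mono (anti g) fun t ht => ?_
  have ht : 0 < t := ht
  rcases lt_or_ge t 1 with h1 | h1
  · obtain ⟨_, ⟨x₀, rfl⟩, hx₀⟩ := (lt_isLUB_iff s₀).1 h1
    obtain ⟨_, ⟨x₁, rfl⟩, hx₁⟩ := (lt_isLUB_iff s₁).1 h1
    refine volume_convex_combination_le (h₀.convex_superlevel ht) (h₁.convex_superlevel ht)
      (hg.convex_superlevel ht) (bdd h₀ t ht) (bdd h₁ t ht) (bdd hg t ht) ⟨x₀, hx₀⟩ ⟨x₁, hx₁⟩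
      ha hb fun x hx y hy => ?_
    have hx : t < f₀ x := hx
    have hy : t < f₁ y := hy
    refine lt_of_lt_of_le ?_ (h x y (ht.trans hx) (ht.trans hy))
    calc t = t ^ a * t ^ b := by rw [← rpow_add ht, hab, rpow_one]
      _ < f₀ x ^ a * f₁ y ^ b := by gcongr
  · have e₀ : {x | t < f₀ x} = ∅ := Set.eq_empty_of_forall_notMem fun x hx =>
      absurd (s₀.1 ⟨x, rfl⟩) (not_le.2 (h1.trans_lt hx))
    have e₁ : {x | t < f₁ x} = ∅ := Set.eq_empty_of_forall_notMem fun x hx =>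
      absurd (s₁.1 ⟨x, rfl⟩) (not_le.2 (h1.trans_lt hx))
    simp [e₀, e₁]

theorem IsLogConcaveWeight.exists_isLUB {D : ℝ} {f : ℝ → ℝ} (h : IsLogConcaveWeight D f)
    (hf : 0 < ∫ x, f x) :
    ∃ M, 0 < M ∧ IsLUB (Set.range fun x => f x / M) 1 := by
  obtain ⟨C, hC⟩ := h.bounded
  have hl : IsLUB (Set.range f) (sSup (Set.range f)) :=
    isLUB_csSup (Set.range_nonempty f) ⟨C, by rintro _ ⟨x, rfl⟩; exact hC x⟩
  have : ∃ x, 0 < f x := by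
    by_contra! hn
    exact absurd hf (not_lt.2 (integral_nonpos hn))
  obtain ⟨x, hx⟩ := this
  have hM : 0 < sSup (Set.range f) := hx.trans_le (hl.1 ⟨x, rfl⟩)
  refine ⟨_, hM, ?_, fun c hc => ?_⟩
  · rintro _ ⟨y, rfl⟩
    exact (div_le_one hM).2 (hl.1 ⟨y, rfl⟩)
  · have : sSup (Set.range f) ≤ c * sSup (Set.range f) := hl.2 (by
      rintro _ ⟨y, rfl⟩
      exact (div_le_iff₀ hM).1 (hc ⟨y, rfl⟩))
    exact (le_mul_iff_one_le_left hM).1 this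

/-- The Prékopa–Leindler inequality on the real line, for log-concave functions. -/
theorem prekopa_real {D : ℝ} {f₀ f₁ g : ℝ → ℝ} (h₀ : IsLogConcaveWeight D f₀)
    (h₁ : IsLogConcaveWeight D f₁) (hg : IsLogConcaveWeight D g) {a b : ℝ} (ha : 0 < a)
    (hb : 0 < b) (hab : a + b = 1)
    (h : ∀ s t, 0 < f₀ s → 0 < f₁ t → f₀ s ^ a * f₁ t ^ b ≤ g (a * s + b * t))
    (p₀ : 0 < ∫ x, f₀ x) (p₁ : 0 < ∫ x, f₁ x) :
    (∫ x, f₀ x) ^ a * (∫ x, f₁ x) ^ b ≤ ∫ x, g x := by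
  obtain ⟨M₀, hM₀, l₀⟩ := h₀.exists_isLUB p₀
  obtain ⟨M₁, hM₁, l₁⟩ := h₁.exists_isLUB p₁
  have hM : 0 < M₀ ^ a * M₁ ^ b := by positivity
  have key := prekopa_normalized (h₀.div_const hM₀) (h₁.div_const hM₁) (hg.div_const hM) ha hb hab
    (fun s t hs ht => by
      have hs' := (div_pos_iff_of_pos_right hM₀).1 hs
      have ht' := (div_pos_iff_of_pos_right hM₁).1 ht
      rw [div_rpow hs'.le hM₀.le, div_rpow ht'.le hM₁.le, div_mul_div_comm]
      gcongr
      exact h s t hs' ht') l₀ l₁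
  rw [integral_div, integral_div, integral_div] at key
  have := (geom_mean_le_arith_mean2_weighted ha.le hb.le (div_nonneg p₀.le hM₀.le)
    (div_nonneg p₁.le hM₁.le) hab).trans key
  rwa [div_rpow p₀.le hM₀.le, div_rpow p₁.le hM₁.le, div_mul_div_comm,
    div_le_div_iff_of_pos_right hM] at this

/-- Marginals of log-concave weights are log-concave weights. -/
theorem IsLogConcaveWeight.marginal {E F : Type*} [NormedAddCommGroup E] [NormedSpace ℝ E]
    [MeasurableSpace E] [NormedAddCommGroup F] [NormedSpace ℝ F] [MeasurableSpace F]
    {D : ℝ} {ρ : E → ℝ} (h : IsLogConcaveWeight D ρ) (L : F × ℝ →ₗ[ℝ] E) (hL : Measurable L)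
    (hL₁ : ∀ p, ‖p.1‖ ≤ ‖L p‖) (hL₂ : ∀ p, |p.2| ≤ ‖L p‖) :
    IsLogConcaveWeight D fun y => ∫ s, ρ (L (y, s)) := by
  have hd : ∀ p q : F × ℝ, 0 < ρ (L p) → 0 < ρ (L q) → ‖L (p - q)‖ ≤ D := fun p q hp hq => by
    rw [map_sub, ← dist_eq_norm]
    exact h.dist_le _ _ hp hq
  have hcomb : ∀ p q : F × ℝ, 0 < ρ (L p) → 0 < ρ (L q) → ∀ a b : ℝ, 0 < a → 0 < b → a + b = 1 →
      ρ (L p) ^ a * ρ (L q) ^ b ≤ ρ (L (a • p + b • q)) := fun p q hp hq a b ha hb hab => by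
    rw [map_add, map_smul, map_smul]
    exact h.rpow_mul_le hp hq ha.le hb.le hab
  obtain ⟨M, hM⟩ := h.bounded
  have slice : ∀ y, IsLogConcaveWeight D fun s => ρ (L (y, s)) := fun y =>
    { nonneg := fun s => h.nonneg _
      measurable := h.measurable.comp (hL.comp (by fun_prop))
      bounded := ⟨M, fun s => hM _⟩
      concaveOn_log := concaveOn_log_of_rpow_mul_le fun s t hs ht a b ha hb hab => by
        have := hcomb (y, s) (y, t) hs ht a b ha hb hab
        have e : a • (y, s) + b • (y, t) = (y, a • s + b • t) := by
          ext1
          · simp [← add_smul, hab]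
          · simp
        rwa [e] at this
      dist_le := fun s t hs ht => by
        rw [Real.dist_eq]
        exact (hL₂ ((y, s) - (y, t))).trans (hd _ _ hs ht) }
  have hex : ∀ y, 0 < ∫ s, ρ (L (y, s)) → ∃ s, 0 < ρ (L (y, s)) := fun y hy => by
    by_contra! hn
    exact absurd hy (not_lt.2 (integral_nonpos hn))
  refine ⟨fun y => integral_nonneg fun s => h.nonneg _, ?_, ?_, ?_, ?_⟩
  · exact (h.measurable.comp hL).stronglyMeasurable.integral_prod_right'.measurable
  · refine ⟨|M| * (2 * |D|), fun y => ?_⟩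
    by_cases hy : ∃ s, 0 < ρ (L (y, s))
    · obtain ⟨s₀, hs₀⟩ := hy
      have e : ∫ s in Set.Icc (s₀ - |D|) (s₀ + |D|), ρ (L (y, s)) = ∫ s, ρ (L (y, s)) :=
        setIntegral_eq_integral_of_forall_compl_eq_zero fun s hs =>
          (slice y).eq_zero_of_not_pos fun hp => hs (by
            have := (slice y).dist_le s s₀ hp hs₀
            rw [Real.dist_eq] at this
            have := abs_le.1 (this.trans (le_abs_self D))
            constructor <;> linarith [this.1, this.2])
      rw [← e]
      refine (Real.le_norm_self _).trans ((norm_setIntegral_le_of_norm_le_const (C := |M|)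
        measure_Icc_lt_top
        fun s _ => ?_).trans ?_)
      · rw [norm_of_nonneg (h.nonneg _)]
        exact (hM _).trans (le_abs_self M)
      · simp only [Measure.real, Real.volume_Icc]
        rw [ENNReal.toReal_ofReal (by linarith [abs_nonneg D])]
        exact le_of_eq (by ring)
    · push Not at hy
      exact (integral_nonpos hy).trans (by positivity)
  · refine concaveOn_log_of_rpow_mul_le fun y z hy hz a b ha hb hab => ?_
    exact prekopa_real (slice y) (slice z) (slice (a • y + b • z)) ha hb hab
      (fun s t hs ht => hcomb (y, s) (z, t) hs ht a b ha hb hab) hy hz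
  · intro y z hy hz
    obtain ⟨s, hs⟩ := hex y hy
    obtain ⟨t, ht⟩ := hex z hz
    rw [dist_eq_norm]
    exact (hL₁ ((y, s) - (z, t))).trans (hd _ _ hs ht)

theorem isClosed_halfspace {E : Type*} [NormedAddCommGroup E] [InnerProductSpace ℝ E] (v p : E) :
    IsClosed {x : E | 0 ≤ ⟪v, x - p⟫} :=
  isClosed_le continuous_const (by fun_prop)

/-- A convex set with empty interior lies in a hyperplane. -/
theorem exists_hyperplane_of_interior_eq_empty {E : Type*} [NormedAddCommGroup E]
    [InnerProductSpace ℝ E] [FiniteDimensional ℝ E] [Nontrivial E] {C : Set E} (hC : Convex ℝ C)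
    (hi : interior C = ∅) : ∃ e : E, ‖e‖ = 1 ∧ ∃ c : ℝ, ∀ x ∈ C, ⟪e, x⟫ = c := by
  rcases C.eq_empty_or_nonempty with rfl | ⟨p, hp⟩
  · obtain ⟨e, he⟩ := exists_norm_eq E zero_le_one
    exact ⟨e, he, 0, by simp⟩
  have hs : affineSpan ℝ C ≠ ⊤ := fun h => by
    have := hC.interior_nonempty_iff_affineSpan_eq_top.2 h
    simp [hi] at this
  have hd : (affineSpan ℝ C).direction ≠ ⊤ := fun h => hs
    ((AffineSubspace.direction_eq_top_iff_of_nonempty ⟨p, subset_affineSpan ℝ C hp⟩).1 h)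
  have hd' : (affineSpan ℝ C).directionᗮ ≠ ⊥ := fun h => hd
    (Submodule.orthogonal_eq_bot_iff.1 h)
  obtain ⟨w, hw, hw0⟩ := Submodule.exists_mem_ne_zero_of_ne_bot hd'
  refine ⟨(‖w‖⁻¹ : ℝ) • w, by simp [norm_smul, hw0], ⟪(‖w‖⁻¹ : ℝ) • w, p⟫, fun x hx => ?_⟩
  have h1 : x -ᵥ p ∈ (affineSpan ℝ C).direction := AffineSubspace.vsub_mem_direction
    (subset_affineSpan ℝ C hx) (subset_affineSpan ℝ C hp)
  have h2 := (Submodule.mem_orthogonal' _ _).1 hw _ h1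
  rw [vsub_eq_sub, inner_sub_right] at h2
  rw [inner_smul_left, inner_smul_left, sub_eq_zero.1 h2]

section cut
variable {E : Type*} [NormedAddCommGroup E] [InnerProductSpace ℝ E] [FiniteDimensional ℝ E]
  [MeasurableSpace E] [BorelSpace E]

theorem volume_hyperplane {v : E} (hv : v ≠ 0) (p : E) :
    volume {x : E | ⟪v, x - p⟫ = 0} = 0 := by
  have h := Measure.addHaar_affineSubspace (volume : Measure E)
    (AffineSubspace.mk' p (ℝ ∙ v)ᗮ) (fun htop => by
      have hd : (AffineSubspace.mk' p (ℝ ∙ v)ᗮ).direction = ⊤ := by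
        rw [htop, AffineSubspace.direction_top]
      rw [AffineSubspace.direction_mk'] at hd
      have : v ∈ (ℝ ∙ v)ᗮ := by rw [hd]; trivial
      rw [Submodule.mem_orthogonal_singleton_iff_inner_right, inner_self_eq_zero] at this
      exact hv this)
  convert h using 2
  ext x
  simp [AffineSubspace.mem_mk', Submodule.mem_orthogonal_singleton_iff_inner_right]

theorem setIntegral_halfspace_add {F : E → ℝ} (hF : Integrable F) {v : E} (hv : v ≠ 0) (p : E) :
    (∫ x in {x : E | 0 ≤ ⟪v, x - p⟫}, F x) + ∫ x in {x : E | 0 ≤ ⟪-v, x - p⟫}, F x = ∫ x, F x := by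
  have e : {x : E | 0 ≤ ⟪-v, x - p⟫} =ᵐ[volume] ({x : E | 0 ≤ ⟪v, x - p⟫}ᶜ : Set E) := by
    have : ∀ᵐ x : E, ¬ ⟪v, x - p⟫ = 0 := by
      rw [ae_iff]; simpa using volume_hyperplane hv p
    filter_upwards [this] with x hx
    apply propext
    change 0 ≤ ⟪-v, x - p⟫ ↔ ¬ 0 ≤ ⟪v, x - p⟫
    rw [inner_neg_left, not_le]
    constructor
    · intro h; exact lt_of_le_of_ne (by linarith) hx
    · intro h; linarith
  rw [setIntegral_congr_set e]
  exact integral_add_compl (isClosed_halfspace v p).measurableSet hF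

theorem continuous_setIntegral_halfspace {F : E → ℝ} (hF : Integrable F) {v : ℝ → E}
    (hv : Continuous v) (hv0 : ∀ θ, v θ ≠ 0) (p : E) :
    Continuous fun θ => ∫ x in {x : E | 0 ≤ ⟪v θ, x - p⟫}, F x := by
  have e : (fun θ => ∫ x in {x : E | 0 ≤ ⟪v θ, x - p⟫}, F x) =
      fun θ => ∫ x, {x : E | 0 ≤ ⟪v θ, x - p⟫}.indicator F x := by
    ext θ; rw [integral_indicator (isClosed_halfspace _ _).measurableSet]
  rw [e]
  refine continuous_iff_continuousAt.2 fun θ₀ => ?_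
  refine continuousAt_of_dominated (bound := fun x => ‖F x‖) ?_ ?_ hF.norm ?_
  · exact Eventually.of_forall fun θ =>
      hF.aestronglyMeasurable.indicator (isClosed_halfspace _ _).measurableSet
  · exact Eventually.of_forall fun θ => Eventually.of_forall fun x => norm_indicator_le_norm_self _ _
  · have : ∀ᵐ x : E, ¬ ⟪v θ₀, x - p⟫ = 0 := by
      rw [ae_iff]; simpa using volume_hyperplane (hv0 θ₀) p
    filter_upwards [this] with x hx
    have hc : Continuous fun θ => ⟪v θ, x - p⟫ := by fun_prop
    rcases lt_or_gt_of_ne hx with hx | hx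
    · have : ∀ᶠ θ in nhds θ₀, ⟪v θ, x - p⟫ < 0 := hc.continuousAt.eventually_lt_const hx
      refine continuousAt_const.congr (f := fun _ => 0) ?_
      filter_upwards [this] with θ hθ
      exact (Set.indicator_of_notMem (by simpa using hθ) _).symm
    · have : ∀ᶠ θ in nhds θ₀, 0 < ⟪v θ, x - p⟫ := hc.continuousAt.eventually_const_lt hx
      refine continuousAt_const.congr (f := fun _ => F x) ?_
      filter_upwards [this] with θ hθ
      exact (Set.indicator_of_mem (by simpa using hθ.le) _).symm

/-- A half-space through a prescribed point on which `F` still has zero integral and `G` still has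
negative integral. -/
theorem exists_halfspace_cut (hE : 2 ≤ Module.finrank ℝ E) {F G : E → ℝ} (hF : Integrable F)
    (hG : Integrable G) (F0 : ∫ x, F x = 0) (G0 : ∫ x, G x < 0) (p : E) :
    ∃ v : E, v ≠ 0 ∧ ∫ x in {x : E | 0 ≤ ⟪v, x - p⟫}, F x = 0 ∧
      ∫ x in {x : E | 0 ≤ ⟪v, x - p⟫}, G x < 0 := by
  set b := stdOrthonormalBasis ℝ E
  set e₀ := b ⟨0, by omega⟩
  set e₁ := b ⟨1, by omega⟩
  have h00 : ⟪e₀, e₀⟫ = 1 := by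
    rw [real_inner_self_eq_norm_sq, b.orthonormal.1]; norm_num
  have h01 : ⟪e₁, e₀⟫ = 0 := b.orthonormal.2 (by simp)
  have h11 : ⟪e₁, e₁⟫ = 1 := by
    rw [real_inner_self_eq_norm_sq, b.orthonormal.1]; norm_num
  have h10 : ⟪e₀, e₁⟫ = 0 := b.orthonormal.2 (by simp)
  set v : ℝ → E := fun θ => cos θ • e₀ + sin θ • e₁ with hvdef
  have hv : Continuous v := by fun_prop
  have hv0 : ∀ θ, v θ ≠ 0 := fun θ h => by
    have h1 : ⟪v θ, e₀⟫ = cos θ := by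
      simp only [hvdef, inner_add_left, inner_smul_left, h00, h01, conj_trivial]; ring
    have h2 : ⟪v θ, e₁⟫ = sin θ := by
      simp only [hvdef, inner_add_left, inner_smul_left, h10, h11, conj_trivial]; ring
    rw [h, inner_zero_left] at h1 h2
    have := sin_sq_add_cos_sq θ
    rw [← h1, ← h2] at this
    norm_num at this
  have hΦ := continuous_setIntegral_halfspace hF hv hv0 p
  set Φ := fun θ => ∫ x in {x : E | 0 ≤ ⟪v θ, x - p⟫}, F x with hΦdef
  have hsum : Φ 0 + Φ π = 0 := by
    have := setIntegral_halfspace_add hF (hv0 0) p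
    rw [F0] at this
    have e : v π = - v 0 := by simp [hvdef]
    rw [hΦdef]
    simp only [e]
    exact this
  obtain ⟨θ, hθ⟩ : ∃ θ, Φ θ = 0 := by
    rcases le_total (Φ 0) 0 with h | h
    · exact (mem_range_of_exists_le_of_exists_ge hΦ ⟨0, h⟩ ⟨π, by linarith⟩)
    · exact (mem_range_of_exists_le_of_exists_ge hΦ ⟨π, by linarith⟩ ⟨0, h⟩)
  have hFs := setIntegral_halfspace_add hF (hv0 θ) p
  have hGs := setIntegral_halfspace_add hG (hv0 θ) p
  have hθ' : ∫ x in {x : E | 0 ≤ ⟪v θ, x - p⟫}, F x = 0 := hθ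
  by_cases hneg : ∫ x in {x : E | 0 ≤ ⟪v θ, x - p⟫}, G x < 0
  · exact ⟨v θ, hv0 θ, hθ, hneg⟩
  · exact ⟨-v θ, neg_ne_zero.2 (hv0 θ), by linarith, by linarith⟩

/-- Iterated bisection: a decreasing sequence of closed convex sets whose intersection has empty
interior. -/
theorem exists_seq_cut (hE : 2 ≤ Module.finrank ℝ E) {F G : E → ℝ} (hF : Integrable F)
    (hG : Integrable G) (F0 : ∫ x, F x = 0) (G0 : ∫ x, G x < 0) :
    ∃ C : ℕ → Set E, Antitone C ∧ (∀ i, IsClosed (C i)) ∧ (∀ i, Convex ℝ (C i)) ∧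
      (∀ i, ∫ x in C i, F x = 0) ∧ (∀ i, ∫ x in C i, G x < 0) ∧ interior (⋂ i, C i) = ∅ := by
  let S := {C : Set E // IsClosed C ∧ Convex ℝ C ∧ ∫ x in C, F x = 0 ∧ ∫ x in C, G x < 0}
  have step : ∀ (i : ℕ) (C : S), ∃ C' : S, C'.1 ⊆ C.1 ∧
      ∃ v : E, v ≠ 0 ∧ C'.1 ⊆ {x : E | 0 ≤ ⟪v, x - TopologicalSpace.denseSeq E i⟫} := by
    rintro i ⟨C, hC, hCc, hCF, hCG⟩
    have hm := hC.measurableSet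
    rw [← integral_indicator hm] at hCF hCG
    obtain ⟨v, hv, h1, h2⟩ := exists_halfspace_cut hE (hF.indicator hm) (hG.indicator hm) hCF hCG
      (TopologicalSpace.denseSeq E i)
    rw [setIntegral_indicator hm] at h1 h2
    refine ⟨⟨_, (isClosed_halfspace v _).inter hC, Convex.inter ?_ hCc, h1, h2⟩,
      Set.inter_subset_right, v, hv, Set.inter_subset_left⟩
    intro x hx y hy a b ha hb hab
    have hx : 0 ≤ ⟪v, x - TopologicalSpace.denseSeq E i⟫ := hx
    have hy : 0 ≤ ⟪v, y - TopologicalSpace.denseSeq E i⟫ := hy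
    have e : a • x + b • y - TopologicalSpace.denseSeq E i =
        a • (x - TopologicalSpace.denseSeq E i) + b • (y - TopologicalSpace.denseSeq E i) := by
      nth_rewrite 1 [← one_smul ℝ (TopologicalSpace.denseSeq E i), ← hab]
      module
    change 0 ≤ ⟪v, _⟫
    rw [e, inner_add_right, inner_smul_right, inner_smul_right]
    positivity
  choose next hnext hv using step
  let C : ℕ → S := fun i => Nat.rec ⟨Set.univ, isClosed_univ, convex_univ, by simpa, by simpa⟩ next i
  refine ⟨fun i => (C i).1, antitone_nat_of_succ_le fun i => hnext i (C i), fun i => (C i).2.1,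
    fun i => (C i).2.2.1, fun i => (C i).2.2.2.1, fun i => (C i).2.2.2.2, ?_⟩
  by_contra hne
  obtain ⟨i, hx⟩ := (TopologicalSpace.denseRange_denseSeq E).exists_mem_open
    isOpen_interior (Set.nonempty_iff_ne_empty.2 hne)
  obtain ⟨v, hv0, hsub⟩ := hv i (C i)
  have hmem : ∀ᶠ t in nhds (0 : ℝ), TopologicalSpace.denseSeq E i - t • v ∈ ⋂ i, (C i).1 := by
    have hc : ContinuousAt (fun t : ℝ => TopologicalSpace.denseSeq E i - t • v) 0 := by fun_prop
    exact hc.eventually (by simp only [zero_smul, sub_zero]; exact mem_interior_iff_mem_nhds.1 hx)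
  obtain ⟨t, ht, ht0⟩ := ((hmem.filter_mono nhdsWithin_le_nhds).and
    (self_mem_nhdsWithin : Set.Ioi (0 : ℝ) ∈ nhdsWithin 0 (Set.Ioi 0))).exists
  have h1 := hsub (Set.mem_iInter.1 ht (i + 1))
  have h2 : 0 ≤ ⟪v, TopologicalSpace.denseSeq E i - t • v - TopologicalSpace.denseSeq E i⟫ := h1
  rw [sub_sub_cancel_left, inner_neg_right, inner_smul_right, real_inner_self_eq_norm_sq] at h2
  have ht0 : 0 < t := ht0
  have : 0 < ‖v‖ := norm_pos_iff.2 hv0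
  have : 0 < t * ‖v‖ ^ 2 := by positivity
  linarith

theorem exists_thin_cut (hE : 2 ≤ Module.finrank ℝ E) {F G : E → ℝ} (hF : Integrable F)
    (hG : Integrable G) (F0 : ∫ x, F x = 0) (G0 : ∫ x, G x < 0) {B : Set E} (hB : IsCompact B) :
    ∃ e : E, ‖e‖ = 1 ∧ ∃ c : ℝ, ∀ ε > 0, ∃ C : Set E, IsClosed C ∧ Convex ℝ C ∧
      ∫ x in C, F x = 0 ∧ ∫ x in C, G x < 0 ∧ ∀ x ∈ C ∩ B, |c - ⟪e, x⟫| < ε := by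
  have : Nontrivial E := Module.nontrivial_of_finrank_pos (R := ℝ) (by omega)
  obtain ⟨C, hCa, hCcl, hCc, hCF, hCG, hCi⟩ := exists_seq_cut hE hF hG F0 G0
  obtain ⟨e, he, c, hc⟩ := exists_hyperplane_of_interior_eq_empty (convex_iInter hCc) hCi
  refine ⟨e, he, c, fun ε hε => ?_⟩
  have hcl : ∀ i, IsClosed (C i ∩ {x | ε ≤ |c - ⟪e, x⟫|}) := fun i =>
    (hCcl i).inter (isClosed_le continuous_const (by fun_prop))
  obtain ⟨i, hi⟩ := hB.elim_directed_family_closed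
    (fun i => C i ∩ {x | ε ≤ |c - ⟪e, x⟫|}) hcl (by
      refine Set.eq_empty_of_forall_notMem fun x hx => ?_
      have h2 := fun i => (Set.mem_iInter.1 hx.2 i)
      have := hc x (Set.mem_iInter.2 fun i => (h2 i).1)
      have h3 : ε ≤ |c - ⟪e, x⟫| := (h2 0).2
      rw [this, sub_self, abs_zero] at h3
      linarith)
    (directed_of_isDirected_le fun i j hij => Set.inter_subset_inter_left _ (hCa hij))
  refine ⟨C i, hCcl i, hCc i, hCF i, hCG i, fun x hx => ?_⟩
  by_contra! hcon
  exact Set.notMem_empty x (hi ▸ ⟨hx.2, hx.1, hcon⟩)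

end cut

theorem IsLogConcaveWeight.indicator {E : Type*} [NormedAddCommGroup E] [NormedSpace ℝ E]
    [MeasurableSpace E] {D : ℝ} {ρ : E → ℝ} (h : IsLogConcaveWeight D ρ) {C : Set E}
    (hC : Convex ℝ C) (hm : MeasurableSet C) : IsLogConcaveWeight D (C.indicator ρ) := by
  have hpos : ∀ x, 0 < C.indicator ρ x ↔ x ∈ C ∧ 0 < ρ x := fun x => by
    by_cases hx : x ∈ C <;> simp [hx]
  refine ⟨fun x => Set.indicator_nonneg (fun x _ => h.nonneg x) x, h.measurable.indicator hm, ?_,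
    ?_, fun x y hx hy => h.dist_le x y ((hpos x).1 hx).2 ((hpos y).1 hy).2⟩
  · obtain ⟨M, hM⟩ := h.bounded
    exact ⟨M, fun x => (Set.indicator_le_self' (fun _ _ => h.nonneg _) x).trans (hM x)⟩
  · have e : {x | 0 < C.indicator ρ x} = C ∩ {x | 0 < ρ x} := Set.ext hpos
    rw [e]
    refine (h.concaveOn_log.subset Set.inter_subset_right (hC.inter h.concaveOn_log.1)).congr ?_
    exact fun x hx => by rw [Set.indicator_of_mem hx.1]

/-- The arithmetic behind a slice argument: `A1`, `Aw`, `Aq` are weighted integrals and `A1P`, `AwP`,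
`AqP` their perturbations. -/
theorem variance_form_perturbation {κ δ η μ c₀ A1 Aw Aq A1P AwP AqP A2P : ℝ} (hη0 : 0 < η)
    (hη1 : η ≤ 1) (hηδ : η * (2 * κ ^ 2 + 2) ≤ δ) (hμ0 : 0 < μ) (hCF : A1 - c₀ * μ = 0)
    (hCG : Aq - κ ^ 2 * Aw + (δ - κ ^ 2 * c₀ ^ 2) * μ < 0)
    (hproj : κ ^ 2 * (μ * A2P - A1P ^ 2) ≤ μ * AqP) (ew : AwP = A2P - 2 * c₀ * A1P)
    (c₁ : |A1P - A1| ≤ η * μ) (c₂ : |AwP - Aw| ≤ η * μ) (c₃ : |AqP - Aq| ≤ η * μ) : False := by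
  rw [abs_le] at c₂ c₃
  have ct : (A1P - A1) ^ 2 ≤ (η * μ) ^ 2 := sq_le_sq.2 (c₁.trans (le_abs_self _))
  have e1 : μ * A2P - A1P ^ 2 = μ * AwP + c₀ ^ 2 * μ ^ 2 - (A1P - A1) ^ 2 := by
    have : A1 = c₀ * μ := by linarith
    have : A2P = AwP + 2 * c₀ * A1P := by linarith
    subst A1 A2P; ring
  rw [e1] at hproj
  have hlow : κ ^ 2 * (μ * (Aw - η * μ) + c₀ ^ 2 * μ ^ 2 - (η * μ) ^ 2) ≤ μ * (Aq + η * μ) := by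
    refine (mul_le_mul_of_nonneg_left ?_ (sq_nonneg κ)).trans
      (hproj.trans (mul_le_mul_of_nonneg_left (by linarith) hμ0.le))
    have := mul_le_mul_of_nonneg_left (show Aw - η * μ ≤ AwP by linarith) hμ0.le
    linarith
  have h5 : (κ ^ 2 * (Aw + c₀ ^ 2 * μ) - Aq) * μ ≤ μ ^ 2 * (η * (1 + κ ^ 2 + κ ^ 2 * η)) := by
    nlinarith
  have h6 : η * (1 + κ ^ 2 + κ ^ 2 * η) ≤ δ := by
    refine le_trans (mul_le_mul_of_nonneg_left ?_ hη0.le) hηδ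
    nlinarith [mul_nonneg (sq_nonneg κ) (sub_nonneg.2 hη1)]
  have h7 : δ * μ < κ ^ 2 * (Aw + c₀ ^ 2 * μ) - Aq := by linarith
  nlinarith [mul_lt_mul_of_pos_right h7 hμ0, mul_le_mul_of_nonneg_left h6 (sq_nonneg μ)]

section slice
variable {E : Type*} [NormedAddCommGroup E] [InnerProductSpace ℝ E] [FiniteDimensional ℝ E]
  [MeasurableSpace E] [BorelSpace E]

/-- Orthogonal coordinates adapted to a unit vector preserve the volume. -/
theorem exists_measurableEquiv_orthogonal {e : E} (he : ‖e‖ = 1) :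
    ∃ T : ((ℝ ∙ e)ᗮ × ℝ) ≃ᵐ E, MeasurePreserving T ∧ ∀ p, T p = p.1 + p.2 • e := by
  have hd : MeasurePreserving ((ℝ ∙ e).measurableEquivProd (0 : E)) := by
    have := (ℝ ∙ e).measurePreserving_measurableEquivProd (0 : E)
    rwa [InnerProductSpace.euclideanHausdorffMeasure_eq_volume] at this
  have hu := (LinearIsometryEquiv.toSpanUnitSingleton (𝕜 := ℝ) e he).measurePreserving
  have hp := hu.prod (MeasurePreserving.id (volume : Measure (ℝ ∙ e)ᗮ))
  have hsw : MeasurePreserving (Prod.swap : (ℝ ∙ e)ᗮ × ℝ → ℝ × (ℝ ∙ e)ᗮ) :=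
    Measure.measurePreserving_swap
  refine ⟨MeasurableEquiv.prodComm.trans ((MeasurableEquiv.prodCongr
    (LinearIsometryEquiv.toSpanUnitSingleton (𝕜 := ℝ) e he).toHomeomorph.toMeasurableEquiv
    (MeasurableEquiv.refl _)).trans ((ℝ ∙ e).measurableEquivProd (0 : E)).symm), ?_, fun p => ?_⟩
  · exact (hd.symm _).comp (hp.comp hsw)
  · change ((ℝ ∙ e).measurableEquivProd (0 : E)).symm (_, _) = _
    rw [Submodule.measurableEquivProd_symm_apply]
    change (p.2 • e + (p.1 : E)) + 0 = _
    rw [add_zero, add_comm]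

/-- The Poincaré inequality on a hyperplane, transferred to a weight on the whole space along the
orthogonal projection. -/
theorem poincare_projection {κ D c : ℝ} {e : E} (he : ‖e‖ = 1)
    (ih : HasLogConcavePoincare (volume : Measure (ℝ ∙ e)ᗮ) κ D) {ρ : E → ℝ}
    (hρ : IsLogConcaveWeight D ρ) {f : E → ℝ} (hf : ContDiff ℝ 1 f) (hfc : HasCompactSupport f) :
    κ ^ 2 * ((∫ x, ρ x) * (∫ x, ρ x * f (x + (c - ⟪e, x⟫) • e) ^ 2) -
      (∫ x, ρ x * f (x + (c - ⟪e, x⟫) • e)) ^ 2) ≤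
    (∫ x, ρ x) * ∫ x, ρ x * ‖fderiv ℝ f (x + (c - ⟪e, x⟫) • e)‖ ^ 2 := by
  obtain ⟨T, hT, hTe⟩ := exists_measurableEquiv_orthogonal he
  have he' : ⟪e, e⟫ = 1 := by rw [real_inner_self_eq_norm_sq, he]; norm_num
  have horth : ∀ y : (ℝ ∙ e)ᗮ, ⟪e, (y : E)⟫ = 0 := fun y =>
    Submodule.mem_orthogonal_singleton_iff_inner_right.1 y.2
  let L : (ℝ ∙ e)ᗮ × ℝ →ₗ[ℝ] E :=
    (Submodule.subtype _).coprod (LinearMap.toSpanSingleton ℝ E e)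
  have hL : ∀ p, L p = p.1 + p.2 • e := fun p => by
    simp [L, LinearMap.coprod_apply]
  have hLT : ⇑L = T := funext fun p => by rw [hL, hTe]
  have hnorm : ∀ p, ‖L p‖ ^ 2 = ‖p.1‖ ^ 2 + p.2 ^ 2 := fun p => by
    rw [hL, ← real_inner_self_eq_norm_sq, inner_add_left, inner_add_right, inner_add_right,
      inner_smul_left, inner_smul_right, inner_smul_left, inner_smul_right, horth, he',
      real_inner_comm e, horth, real_inner_self_eq_norm_sq]
    simp [sq]
  have hmarg := hρ.marginal L (hLT ▸ T.measurable)
    (fun p => by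
      have := hnorm p
      exact abs_le_of_sq_le_sq' (by nlinarith [sq_nonneg p.2]) (norm_nonneg _) |>.2)
    (fun p => by
      refine abs_le_of_sq_le_sq (by nlinarith [hnorm p, sq_nonneg ‖p.1‖]) (norm_nonneg _))
  have key : ∀ k : E → ℝ, Continuous k → ∫ y : (ℝ ∙ e)ᗮ, (∫ s, ρ (L (y, s))) * k (y + c • e) =
      ∫ x, ρ x * k (x + (c - ⟪e, x⟫) • e) := fun k hk => by
    have hint : Integrable (fun x => ρ x * k (x + (c - ⟪e, x⟫) • e)) :=
      hρ.integrable_mul (by fun_prop)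
    rw [← hT.integral_comp' (g := fun x => ρ x * k (x + (c - ⟪e, x⟫) • e)),
      Measure.volume_eq_prod,
      integral_prod (fun p => ρ (T p) * k (T p + (c - ⟪e, T p⟫) • e))
        (hT.integrable_comp_of_integrable hint)]
    refine integral_congr_ae (Eventually.of_forall fun y => ?_)
    change _ = ∫ s, ρ (T (y, s)) * k (T (y, s) + (c - ⟪e, T (y, s)⟫) • e)
    refine (integral_mul_const _ _).symm.trans (congrArg _ (funext fun s => ?_))
    rw [hLT, hTe]
    simp only [inner_add_right, horth, inner_smul_right, he']
    congr 2
    module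
  set ft : (ℝ ∙ e)ᗮ → ℝ := fun y => f (y + c • e) with hft
  have hder : ∀ y : (ℝ ∙ e)ᗮ, ‖fderiv ℝ ft y‖ ≤ ‖fderiv ℝ f (y + c • e)‖ := fun y => by
    have h1 : HasFDerivAt ft ((fderiv ℝ f (y + c • e)).comp (ℝ ∙ e)ᗮ.subtypeL) y :=
      ((hf.differentiable one_ne_zero _).hasFDerivAt).comp y
        ((ℝ ∙ e)ᗮ.subtypeL.hasFDerivAt.add_const (c • e))
    rw [h1.fderiv]
    refine (ContinuousLinearMap.opNorm_comp_le _ _).trans ?_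
    exact mul_le_of_le_one_right (norm_nonneg _) (Submodule.norm_subtypeL_le _)
  have hftC : ContDiff ℝ 1 ft := hf.comp ((ℝ ∙ e)ᗮ.subtypeL.contDiff.add contDiff_const)
  have hftc : HasCompactSupport ft := by
    refine hfc.comp_isClosedEmbedding (g := fun y : (ℝ ∙ e)ᗮ => (y : E) + c • e) ?_
    refine Isometry.isClosedEmbedding fun y z => ?_
    rw [edist_add_right]; rfl
  have h := ih _ hmarg ft hftC hftc
  have k0 := key (fun _ => 1) continuous_const
  simp only [mul_one] at k0
  have k1 := key f hf.continuous
  have k2 := key (fun x => f x ^ 2) (hf.continuous.pow 2)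
  have k3 := key (fun x => ‖fderiv ℝ f x‖ ^ 2) ((hf.continuous_fderiv one_ne_zero).norm.pow 2)
  simp only [hft] at h
  rw [k0, k1, k2] at h
  refine h.trans (mul_le_mul_of_nonneg_left ?_ (integral_nonneg hρ.nonneg))
  rw [← k3]
  refine integral_mono (hmarg.integrable_mul ((hftC.continuous_fderiv one_ne_zero).norm.pow 2))
    (hmarg.integrable_mul (by
      have := (hf.continuous_fderiv one_ne_zero).norm.pow 2
      fun_prop)) fun y => ?_
  refine mul_le_mul_of_nonneg_left ?_ (hmarg.nonneg y)
  exact pow_le_pow_left₀ (norm_nonneg _) (hder y) 2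

theorem HasLogConcavePoincare.of_hyperplanes (hE : 2 ≤ Module.finrank ℝ E) {κ D : ℝ}
    (ih : ∀ e : E, ‖e‖ = 1 → HasLogConcavePoincare (volume : Measure (ℝ ∙ e)ᗮ) κ D) :
    HasLogConcavePoincare (volume : Measure E) κ D := by
  intro ρ hρ f hf hfc
  by_contra! hcon
  have hqc : Continuous fun x => ‖fderiv ℝ f x‖ ^ 2 := (hf.continuous_fderiv one_ne_zero).norm.pow 2
  have hfcont := hf.continuous
  set q : E → ℝ := fun x => ‖fderiv ℝ f x‖ ^ 2 with hq
  set m := ∫ x, ρ x with hm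
  set I₁ := ∫ x, ρ x * f x with hI₁
  set I₂ := ∫ x, ρ x * f x ^ 2 with hI₂
  change m * ∫ x, ρ x * q x < _ at hcon
  set I₃ := ∫ x, ρ x * q x with hI₃
  have hm0 : 0 < m := by
    refine lt_of_le_of_ne (integral_nonneg hρ.nonneg) fun h => ?_
    rw [← h] at hcon
    nlinarith [mul_nonneg (sq_nonneg κ) (sq_nonneg I₁)]
  set c₀ := I₁ / m with hc₀
  have hc₀m : c₀ * m = I₁ := div_mul_cancel₀ _ hm0.ne'
  set δ := (κ ^ 2 * (I₂ - c₀ * I₁) - I₃) / (2 * m) with hδ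
  have hδm : δ * (2 * m) = κ ^ 2 * (I₂ - c₀ * I₁) - I₃ := div_mul_cancel₀ _ (by positivity)
  have hδ0 : 0 < δ := by
    refine div_pos (pos_of_mul_pos_right ?_ hm0.le) (by positivity)
    rw [← hc₀m] at hcon ⊢
    nlinarith
  set w : E → ℝ := fun x => f x ^ 2 - 2 * c₀ * f x with hw
  have hwc : Continuous w := by fun_prop
  have expandF : ∀ {ρ : E → ℝ}, IsLogConcaveWeight D ρ → ∫ x, ρ x * (f x - c₀) =
      (∫ x, ρ x * f x) - c₀ * ∫ x, ρ x := fun {ρ} h => by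
    rw [← integral_const_mul, ← integral_sub (h.integrable_mul hfcont) (h.integrable.const_mul _)]
    exact integral_congr_ae (Eventually.of_forall fun x => by ring)
  have expandG : ∀ {ρ : E → ℝ}, IsLogConcaveWeight D ρ →
      ∫ x, ρ x * (q x - κ ^ 2 * (f x - c₀) ^ 2 + δ) =
      (∫ x, ρ x * q x) - κ ^ 2 * (∫ x, ρ x * w x) + (δ - κ ^ 2 * c₀ ^ 2) * ∫ x, ρ x :=
    fun {ρ} h => by
    have i₁ := h.integrable_mul (μ := volume) hqc
    have i₂ := (h.integrable_mul (μ := volume) hwc).const_mul (κ ^ 2)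
    have i₃ := (i₁.sub i₂ : Integrable fun x => ρ x * q x - κ ^ 2 * (ρ x * w x))
    rw [← integral_const_mul, ← integral_const_mul, ← integral_sub i₁ i₂,
      ← integral_add i₃ (h.integrable.const_mul _)]
    exact integral_congr_ae (Eventually.of_forall fun x => by simp only [hw]; ring)
  have expandw : ∀ {ρ : E → ℝ}, IsLogConcaveWeight D ρ → ∀ {P : E → E}, Continuous P →
      ∫ x, ρ x * w (P x) = (∫ x, ρ x * f (P x) ^ 2) - 2 * c₀ * ∫ x, ρ x * f (P x) :=
    fun {ρ} h {P} hP => by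
    rw [← integral_const_mul, ← integral_sub
      (h.integrable_mul (g := fun x => f (P x) ^ 2) (by fun_prop))
      ((h.integrable_mul (g := fun x => f (P x)) (by fun_prop)).const_mul _)]
    exact integral_congr_ae (Eventually.of_forall fun x => by simp only [hw]; ring)
  obtain ⟨e, he, c, hcut⟩ := exists_thin_cut hE
    (hρ.integrable_mul (g := fun x => f x - c₀) (by fun_prop))
    (hρ.integrable_mul (g := fun x => q x - κ ^ 2 * (f x - c₀) ^ 2 + δ) (by fun_prop))
    (by rw [expandF hρ, hc₀m, sub_self])
    (by
      rw [expandG hρ, expandw hρ continuous_id']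
      simp only [← hI₁, ← hI₂, ← hI₃, ← hm]
      rw [← hc₀m] at hδm ⊢
      nlinarith [mul_pos hδ0 hm0])
    hρ.isBounded.isCompact_closure
  set η := min 1 (δ / (2 * κ ^ 2 + 2)) with hη
  have hη0 : 0 < η := by positivity
  have hη1 : η ≤ 1 := min_le_left _ _
  have hηδ : η * (2 * κ ^ 2 + 2) ≤ δ := (le_div_iff₀ (by positivity)).1 (min_le_right _ _)
  have modulus : ∀ k : E → ℝ, Continuous k → HasCompactSupport k →
      ∃ ε > 0, ∀ x z, dist x z < ε → |k x - k z| ≤ η := fun k hk hkc => by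
    obtain ⟨ε, hε, h⟩ := Metric.uniformContinuous_iff.1 (hkc.uniformContinuous_of_continuous hk) η hη0
    exact ⟨ε, hε, fun x z hxz => (h hxz).le⟩
  obtain ⟨ε₁, hε₁, h₁⟩ := modulus f hfcont hfc
  obtain ⟨ε₂, hε₂, h₂⟩ := modulus w hwc (by
    refine hfc.mono fun x hx => ?_
    contrapose! hx
    simp [hw, Function.notMem_support.1 hx])
  obtain ⟨ε₃, hε₃, h₃⟩ := modulus q hqc (by
    refine (hfc.fderiv (𝕜 := ℝ)).mono fun x hx => ?_
    contrapose! hx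
    simp [hq, Function.notMem_support.1 hx])
  obtain ⟨C, hCcl, hCc, hCF, hCG, hCε⟩ := hcut (min ε₁ (min ε₂ ε₃)) (by positivity)
  have hρ' := hρ.indicator hCc hCcl.measurableSet
  have hrestr : ∀ k : E → ℝ, ∫ x in C, ρ x * k x = ∫ x, C.indicator ρ x * k x := fun k => by
    rw [← integral_indicator hCcl.measurableSet]
    exact integral_congr_ae (Eventually.of_forall fun x => by
      by_cases hx : x ∈ C <;> simp [hx])
  rw [hrestr, expandF hρ'] at hCF
  rw [hrestr, expandG hρ'] at hCG
  have hproj := poincare_projection (c := c) he (ih e he) hρ' hf hfc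
  have hsupp : ∀ x, 0 < C.indicator ρ x → |c - ⟪e, x⟫| < min ε₁ (min ε₂ ε₃) := fun x hx => by
    have hxC : x ∈ C := by
      by_contra hn
      simp [hn] at hx
    rw [Set.indicator_of_mem hxC] at hx
    exact hCε x ⟨hxC, subset_closure hx⟩
  set σ := C.indicator ρ with hσ
  set P : E → E := fun x => x + (c - ⟪e, x⟫) • e with hP
  have hPc : Continuous P := by fun_prop
  set μ := ∫ x, σ x with hμ
  have close : ∀ k : E → ℝ, Continuous k →
      (∀ x z, dist x z < min ε₁ (min ε₂ ε₃) → |k x - k z| ≤ η) →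
      |(∫ x, σ x * k (P x)) - ∫ x, σ x * k x| ≤ η * μ := fun k hk hkε => by
    rw [← integral_sub (hρ'.integrable_mul (g := fun x => k (P x)) (by fun_prop))
      (hρ'.integrable_mul hk), ← integral_const_mul]
    refine abs_integral_le_integral_abs.trans (integral_mono_of_nonneg
      (Eventually.of_forall fun x => abs_nonneg _) (hρ'.integrable.const_mul _)
      (Eventually.of_forall fun x => ?_))
    change |σ x * k (P x) - σ x * k x| ≤ η * σ x
    rw [← mul_sub, abs_mul, abs_of_nonneg (hρ'.nonneg x), mul_comm]
    by_cases hx : 0 < σ x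
    · refine mul_le_mul_of_nonneg_right (hkε _ _ ?_) hx.le
      rw [dist_eq_norm, hP]
      simp only [add_sub_cancel_left, norm_smul, he, mul_one]
      exact hsupp x hx
    · rw [hρ'.eq_zero_of_not_pos hx, mul_zero, mul_zero]
  have c₁ := close f hfcont fun x z h => h₁ x z (h.trans_le (min_le_left _ _))
  have c₂ := close w hwc fun x z h =>
    h₂ x z (h.trans_le ((min_le_right _ _).trans (min_le_left _ _)))
  have c₃ := close q hqc fun x z h =>
    h₃ x z (h.trans_le ((min_le_right _ _).trans (min_le_right _ _)))
  have hμ0 : 0 < μ := by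
    refine lt_of_le_of_ne (integral_nonneg hρ'.nonneg) fun h => ?_
    have hz : σ =ᵐ[volume] 0 := (integral_eq_zero_iff_of_nonneg hρ'.nonneg hρ'.integrable).1 h.symm
    have hz' : ∀ k : E → ℝ, ∫ x, σ x * k x = 0 := fun k => by
      rw [← integral_zero E ℝ]
      refine integral_congr_ae ?_
      filter_upwards [hz] with x hx
      rw [hx]; simp
    rw [hz', hz', ← h] at hCG
    simp at hCG
  have ew := expandw hρ' hPc
  change κ ^ 2 * (μ * (∫ x, σ x * f (P x) ^ 2) - (∫ x, σ x * f (P x)) ^ 2) ≤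
    μ * ∫ x, σ x * q (P x) at hproj
  exact variance_form_perturbation hη0 hη1 hηδ hμ0 hCF hCG hproj ew c₁ c₂ c₃

end slice

theorem HasLogConcavePoincare.of_linearIsometryEquiv {E F : Type*} [NormedAddCommGroup E]
    [InnerProductSpace ℝ E] [FiniteDimensional ℝ E] [MeasurableSpace E] [BorelSpace E]
    [NormedAddCommGroup F] [InnerProductSpace ℝ F] [FiniteDimensional ℝ F] [MeasurableSpace F]
    [BorelSpace F] {κ D : ℝ} (h : HasLogConcavePoincare (volume : Measure E) κ D) (T : E ≃ₗᵢ[ℝ] F) :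
    HasLogConcavePoincare (volume : Measure F) κ D := by
  intro ρ hρ f hf hfc
  have hI : ∀ k : F → ℝ, ∫ x, k (T x) = ∫ y, k y := fun k =>
    T.measurePreserving.integral_comp T.toHomeomorph.measurableEmbedding k
  have hw : IsLogConcaveWeight D (ρ ∘ T) := by
    refine ⟨fun x => hρ.nonneg _, hρ.measurable.comp T.continuous.measurable, ?_, ?_, fun x y hx hy =>
      by rw [← T.dist_map]; exact hρ.dist_le _ _ hx hy⟩
    · obtain ⟨M, hM⟩ := hρ.bounded
      exact ⟨M, fun x => hM _⟩
    · exact hρ.concaveOn_log.comp_linearMap T.toLinearEquiv.toLinearMap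
  have hfT := h _ hw (f ∘ T) (hf.comp T.contDiff) (hfc.comp_homeomorph T.toHomeomorph)
  have hder : ∀ x, ‖fderiv ℝ (f ∘ T) x‖ = ‖fderiv ℝ f (T x)‖ := fun x => by
    have := (hf.differentiable one_ne_zero (T x)).hasFDerivAt.comp x
      T.toContinuousLinearEquiv.hasFDerivAt
    rw [HasFDerivAt.fderiv this]
    exact ContinuousLinearMap.opNorm_comp_linearIsometryEquiv _ T
  simp only [hder, Function.comp_apply] at hfT
  rwa [hI ρ, hI fun y => ρ y * f y ^ 2, hI fun y => ρ y * f y,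
    hI fun y => ρ y * ‖fderiv ℝ f y‖ ^ 2] at hfT

/-- The Payne–Weinberger inequality for log-concave weights in every dimension. -/
theorem hasLogConcavePoincare_of_finrank {κ D : ℝ} (hκ : 0 < κ) (hκD : κ * D < π) (n : ℕ) :
    ∀ (E : Type*) [NormedAddCommGroup E] [InnerProductSpace ℝ E] [FiniteDimensional ℝ E]
      [MeasurableSpace E] [BorelSpace E], Module.finrank ℝ E = n + 1 →
      HasLogConcavePoincare (volume : Measure E) κ D := by
  induction n with
  | zero =>
    intro E _ _ _ _ _ hE
    have hE : Module.finrank ℝ E = 1 := hE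
    have : Nontrivial E := Module.nontrivial_of_finrank_pos (R := ℝ) (by omega)
    obtain ⟨e, he⟩ := exists_norm_eq E zero_le_one
    have htop : (ℝ ∙ e) = ⊤ :=
      (finrank_eq_one_iff_of_nonzero e (by rintro rfl; simp at he)).1 hE
    exact (hasLogConcavePoincare_real hκ hκD).of_linearIsometryEquiv
      ((LinearIsometryEquiv.toSpanUnitSingleton (𝕜 := ℝ) e he).trans
        (LinearIsometryEquiv.ofTop E _ htop))
  | succ n ih =>
    intro E _ _ _ _ _ hE
    refine HasLogConcavePoincare.of_hyperplanes (by omega) fun e he => ih _ ?_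
    have : Fact (Module.finrank ℝ E = n + 1 + 1) := ⟨hE⟩
    exact Submodule.finrank_orthogonal_span_singleton (by rintro rfl; simp at he)

section gradient
variable {E : Type*} [NormedAddCommGroup E] [InnerProductSpace ℝ E] [CompleteSpace E]

theorem norm_gradient (f : E → ℝ) (x : E) : ‖gradient f x‖ = ‖fderiv ℝ f x‖ := by
  rw [← toDual_gradient, LinearIsometryEquiv.norm_map]

theorem gradient_sub_apply {f g : E → ℝ} {x : E} (hf : DifferentiableAt ℝ f x)
    (hg : DifferentiableAt ℝ g x) :
    gradient (fun y => f y - g y) x = gradient f x - gradient g x := by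
  simp only [gradient]
  rw [fderiv_fun_sub hf hg, map_sub]

theorem gradient_mul_apply {f g : E → ℝ} {x : E} (hf : DifferentiableAt ℝ f x)
    (hg : DifferentiableAt ℝ g x) :
    gradient (fun y => f y * g y) x = f x • gradient g x + g x • gradient f x := by
  simp only [gradient]
  rw [fderiv_fun_mul hf hg, map_add, map_smulₛₗ, map_smulₛₗ]
  simp

theorem continuousOn_gradient {Ω : Set E} (hΩ : IsOpen Ω) {u : E → ℝ} (hu : ContDiffOn ℝ 1 u Ω) :
    ContinuousOn (gradient u) Ω := by
  have := hu.continuousOn_fderiv_of_isOpen hΩ le_rfl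
  exact (InnerProductSpace.toDual ℝ E).symm.continuous.comp_continuousOn this

theorem continuous_gradient {u : E → ℝ} (hu : ContDiff ℝ 1 u) : Continuous (gradient u) :=
  continuousOn_univ.1 (continuousOn_gradient isOpen_univ hu.contDiffOn)

theorem gradient_eq_zero_of_notMem_tsupport {f : E → ℝ} {x : E} (hx : x ∉ tsupport f) :
    gradient f x = 0 := by
  have : fderiv ℝ f x = 0 := by
    by_contra h
    exact hx (support_fderiv_subset ℝ h)
  simp [gradient, this]

end gradient

section weak
variable {E : Type*} [NormedAddCommGroup E] [InnerProductSpace ℝ E] [FiniteDimensional ℝ E]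
  [MeasurableSpace E] [BorelSpace E]

/-- Compactly supported `C¹` functions are `C¹`-limits of smooth ones with nearby supports. -/
theorem exists_smooth_approx {φ : E → ℝ} (hφ : ContDiff ℝ 1 φ) (hc : HasCompactSupport φ) {δ ε : ℝ}
    (hδ : 0 < δ) (hε : 0 < ε) :
    ∃ ψ : E → ℝ, ContDiff ℝ (⊤ : ℕ∞) ψ ∧ HasCompactSupport ψ ∧
      tsupport ψ ⊆ Metric.cthickening δ (tsupport φ) ∧ (∀ x, |ψ x - φ x| ≤ ε) ∧
      ∀ x, ‖fderiv ℝ ψ x - fderiv ℝ φ x‖ ≤ ε := by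
  have hd : Continuous (fderiv ℝ φ) := hφ.continuous_fderiv one_ne_zero
  obtain ⟨r₁, hr₁, h₁⟩ := Metric.uniformContinuous_iff.1
    (hc.uniformContinuous_of_continuous hφ.continuous) ε hε
  obtain ⟨r₂, hr₂, h₂⟩ := Metric.uniformContinuous_iff.1
    ((hc.fderiv (𝕜 := ℝ)).uniformContinuous_of_continuous hd) ε hε
  have hr : 0 < min δ (min r₁ r₂) := by positivity
  let b : ContDiffBump (0 : E) := ⟨min δ (min r₁ r₂) / 2, min δ (min r₁ r₂), by linarith, by linarith⟩
  have hbr : b.rOut = min δ (min r₁ r₂) := rfl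
  set ψ : E → ℝ := MeasureTheory.convolution (b.normed volume) φ (ContinuousLinearMap.lsmul ℝ ℝ)
    volume with hψ
  have hsupp : Function.support ψ ⊆ Metric.cthickening δ (tsupport φ) := by
    refine (support_convolution_subset_swap _).trans ?_
    rintro _ ⟨x, hx, y, hy, rfl⟩
    rw [b.support_normed_eq, mem_ball_zero_iff, hbr] at hy
    refine Metric.mem_cthickening_of_dist_le _ x _ _ (subset_tsupport _ hx) ?_
    simpa using (hy.trans_le (min_le_left _ _)).le
  have htsupp : tsupport ψ ⊆ Metric.cthickening δ (tsupport φ) :=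
    closure_minimal hsupp Metric.isClosed_cthickening
  refine ⟨ψ, ?_, ?_, htsupp, fun x => ?_, fun x => ?_⟩
  · exact b.hasCompactSupport_normed.contDiff_convolution_left _ b.contDiff_normed
      hφ.continuous.locallyIntegrable
  · exact hc.isCompact.cthickening.of_isClosed_subset (isClosed_tsupport _) htsupp
  · rw [← Real.dist_eq]
    refine ContDiffBump.dist_normed_convolution_le hφ.continuous.aestronglyMeasurable fun y hy => ?_
    exact (h₁ ((Metric.mem_ball.1 hy).trans_le ((min_le_right _ _).trans (min_le_left _ _)))).le
  · have hder := hc.hasFDerivAt_convolution_right (ContinuousLinearMap.lsmul ℝ ℝ)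
      ((b.continuous_normed (μ := volume)).locallyIntegrable (μ := volume)) hφ x
    have e : (ContinuousLinearMap.lsmul ℝ ℝ : ℝ →L[ℝ] ℝ →L[ℝ] ℝ).precompR E =
        ContinuousLinearMap.lsmul ℝ ℝ := by
      ext; simp
    rw [hder.fderiv, e, ← dist_eq_norm]
    refine ContDiffBump.dist_normed_convolution_le hd.aestronglyMeasurable fun y hy => ?_
    exact (h₂ ((Metric.mem_ball.1 hy).trans_le ((min_le_right _ _).trans (min_le_right _ _)))).le

theorem integrableOn_of_continuousOn_of_tsupport {Ω : Set E} (hΩ : IsOpen Ω) {g : E → ℝ}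
    (hg : ContinuousOn g Ω) {K : Set E} (hK : IsCompact K) (hKΩ : K ⊆ Ω)
    (h0 : ∀ x ∈ Ω, x ∉ K → g x = 0) : IntegrableOn g Ω := by
  have h1 : IntegrableOn g K := (hg.mono hKΩ).integrableOn_compact hK
  exact h1.of_forall_sdiff_eq_zero hΩ.measurableSet fun x hx => h0 x hx.1 hx.2

/-- A weak equation tested against smooth functions may be tested against `C¹` functions. -/
theorem weak_equation_extend {Ω : Set E} (hΩ : IsOpen Ω) {u : E → ℝ} (hu : ContDiffOn ℝ 1 u Ω)
    {l : ℝ} (heq : ∀ φ : E → ℝ, ContDiff ℝ (⊤ : ℕ∞) φ → HasCompactSupport φ → tsupport φ ⊆ Ω →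
      ∫ x in Ω, ⟪gradient u x, gradient φ x⟫ = l * ∫ x in Ω, u x * φ x)
    {φ : E → ℝ} (hφ : ContDiff ℝ 1 φ) (hc : HasCompactSupport φ) (hs : tsupport φ ⊆ Ω) :
    ∫ x in Ω, ⟪gradient u x, gradient φ x⟫ = l * ∫ x in Ω, u x * φ x := by
  obtain ⟨δ, hδ, hδΩ⟩ := hc.isCompact.exists_cthickening_subset_open hΩ hs
  set K := Metric.cthickening δ (tsupport φ) with hKdef
  have hK : IsCompact K := hc.isCompact.cthickening
  have hφK : tsupport φ ⊆ K := Metric.self_subset_cthickening _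
  obtain ⟨M₁, hM₁⟩ := hK.exists_bound_of_continuousOn ((continuousOn_gradient hΩ hu).mono hδΩ)
  obtain ⟨M₂, hM₂⟩ := hK.exists_bound_of_continuousOn (hu.continuousOn.mono hδΩ)
  have hint : ∀ χ : E → ℝ, ContDiff ℝ 1 χ → tsupport χ ⊆ K →
      IntegrableOn (fun x => ⟪gradient u x, gradient χ x⟫) Ω ∧
      IntegrableOn (fun x => u x * χ x) Ω := fun χ hχ hχK => by
    constructor
    · refine integrableOn_of_continuousOn_of_tsupport hΩ
        ((continuousOn_gradient hΩ hu).inner (continuous_gradient hχ).continuousOn) hK hδΩ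
        fun x _ hx => ?_
      rw [gradient_eq_zero_of_notMem_tsupport fun h => hx (hχK h), inner_zero_right]
    · refine integrableOn_of_continuousOn_of_tsupport hΩ
        (hu.continuousOn.mul hχ.continuous.continuousOn) hK hδΩ fun x _ hx => ?_
      rw [image_eq_zero_of_notMem_tsupport fun h => hx (hχK h), mul_zero]
  set Λ : (E → ℝ) → ℝ := fun χ =>
    (∫ x in Ω, ⟪gradient u x, gradient χ x⟫) - l * ∫ x in Ω, u x * χ x with hΛ
  have hbound : ∀ ε > 0, |Λ φ| ≤ ε * ((M₁ + |l| * M₂) * volume.real K) := fun ε hε => by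
    obtain ⟨ψ, hψ, hψc, hψs, hψ0, hψ1⟩ := exists_smooth_approx hφ hc hδ hε
    have hψ' : ContDiff ℝ 1 ψ := hψ.of_le (by exact_mod_cast le_top)
    have hz : Λ ψ = 0 := sub_eq_zero.2 (heq ψ hψ hψc (hψs.trans hδΩ))
    obtain ⟨i₁, i₂⟩ := hint φ hφ hφK
    obtain ⟨j₁, j₂⟩ := hint ψ hψ' hψs
    have e : Λ φ = -∫ x in K, (⟪gradient u x, gradient ψ x - gradient φ x⟫ -
        l * (u x * (ψ x - φ x))) := by
      rw [← sub_zero (Λ φ), ← hz, hΛ]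
      have e1 : ∫ x in K, (⟪gradient u x, gradient ψ x - gradient φ x⟫ -
          l * (u x * (ψ x - φ x))) = ∫ x in Ω, (⟪gradient u x, gradient ψ x - gradient φ x⟫ -
          l * (u x * (ψ x - φ x))) := by
        refine (setIntegral_eq_of_subset_of_forall_sdiff_eq_zero hΩ.measurableSet hδΩ
          fun x hx => ?_).symm
        rw [gradient_eq_zero_of_notMem_tsupport fun h => hx.2 (hφK h),
          gradient_eq_zero_of_notMem_tsupport fun h => hx.2 (hψs h),
          image_eq_zero_of_notMem_tsupport fun h => hx.2 (hφK h),
          image_eq_zero_of_notMem_tsupport fun h => hx.2 (hψs h)]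
        simp
      have e2 : ∫ x in Ω, (⟪gradient u x, gradient ψ x - gradient φ x⟫ -
          l * (u x * (ψ x - φ x))) = ∫ x in Ω, ((⟪gradient u x, gradient ψ x⟫ -
          ⟪gradient u x, gradient φ x⟫) - (l * (u x * ψ x) - l * (u x * φ x))) := by
        congr 1; ext x; rw [inner_sub_right]; ring
      have a₁ : IntegrableOn (fun x => ⟪gradient u x, gradient ψ x⟫ -
          ⟪gradient u x, gradient φ x⟫) Ω := j₁.sub i₁
      have a₂ : IntegrableOn (fun x => l * (u x * ψ x) - l * (u x * φ x)) Ω :=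
        (j₂.const_mul l).sub (i₂.const_mul l)
      rw [e1, e2, integral_sub a₁ a₂, integral_sub j₁ i₁, integral_sub (j₂.const_mul l) (i₂.const_mul l), integral_const_mul,
        integral_const_mul]
      ring
    rw [e, abs_neg, ← Real.norm_eq_abs]
    have := norm_setIntegral_le_of_norm_le_const (μ := volume) (s := K)
      (f := fun x => ⟪gradient u x, gradient ψ x - gradient φ x⟫ - l * (u x * (ψ x - φ x)))
      (C := ε * (M₁ + |l| * M₂)) hK.measure_lt_top fun x hx => by
        have a1 : ‖gradient ψ x - gradient φ x‖ ≤ ε := by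
          rw [← gradient_sub_apply (hψ'.differentiable one_ne_zero _)
            (hφ.differentiable one_ne_zero _), norm_gradient,
            fderiv_fun_sub (hψ'.differentiable one_ne_zero _) (hφ.differentiable one_ne_zero _)]
          exact hψ1 x
        have a2 := hM₁ x hx
        have a3 := hM₂ x hx
        have a4 := norm_inner_le_norm (𝕜 := ℝ) (gradient u x) (gradient ψ x - gradient φ x)
        refine (norm_sub_le _ _).trans ?_
        have b1 : ‖⟪gradient u x, gradient ψ x - gradient φ x⟫‖ ≤ M₁ * ε :=
          a4.trans (mul_le_mul a2 a1 (norm_nonneg _) ((norm_nonneg _).trans a2))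
        have b2 : ‖l * (u x * (ψ x - φ x))‖ ≤ |l| * (M₂ * ε) := by
          rw [norm_mul, norm_mul]
          exact mul_le_mul_of_nonneg_left (mul_le_mul a3 (hψ0 x) (norm_nonneg _)
            ((norm_nonneg _).trans a3)) (norm_nonneg _)
        linarith
    rwa [mul_assoc] at this
  have hlim : Tendsto (fun ε : ℝ => ε * ((M₁ + |l| * M₂) * volume.real K))
      (nhdsWithin 0 (Set.Ioi 0)) (nhds 0) := by
    have : Continuous fun ε : ℝ => ε * ((M₁ + |l| * M₂) * volume.real K) := by fun_prop
    simpa using (this.tendsto 0).mono_left nhdsWithin_le_nhds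
  have := ge_of_tendsto hlim (eventually_nhdsWithin_of_forall hbound)
  exact sub_eq_zero.1 (abs_eq_zero.1 (le_antisymm this (abs_nonneg _)))

end weak

/-- `C¹` truncations of the identity that vanish near the origin. -/
theorem exists_truncation : ∃ η θ : ℕ → ℝ → ℝ, (∀ k, Continuous (θ k)) ∧
    (∀ k s, HasDerivAt (η k) (θ k s) s) ∧ (∀ k s, 0 ≤ θ k s ∧ θ k s ≤ 1) ∧
    (∀ k, ∃ ε > 0, ∀ s, |s| ≤ ε → η k s = 0) ∧ (∀ k s, |η k s| ≤ |s|) ∧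
    ∀ s, Tendsto (fun k => η k s) atTop (nhds s) := by
  set θ : ℕ → ℝ → ℝ := fun k t => min 1 (max 0 ((k + 1) * |t| - 1)) with hθ
  have hc : ∀ k, Continuous (θ k) := fun k => by fun_prop
  have h01 : ∀ k s, 0 ≤ θ k s ∧ θ k s ≤ 1 := fun k s =>
    ⟨le_min zero_le_one (le_max_left _ _), min_le_left _ _⟩
  refine ⟨fun k s => ∫ t in (0 : ℝ)..s, θ k t, θ, hc, fun k s => (hc k).integral_hasStrictDerivAt 0 s
    |>.hasDerivAt, h01, fun k => ⟨1 / (k + 1), by positivity, fun s hs => ?_⟩, fun k s => ?_,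
    fun s => ?_⟩
  · refine (intervalIntegral.integral_congr fun t ht => ?_).trans
      (intervalIntegral.integral_zero (E := ℝ) (a := 0) (b := s) (μ := volume))
    have hts : |t| ≤ |s| := by simpa using Set.abs_sub_left_of_mem_uIcc ht
    have : (k + 1) * |t| ≤ 1 := by
      have := (le_div_iff₀ (by positivity)).1 (hts.trans hs)
      linarith
    simp only [hθ]
    rw [max_eq_left (by linarith), min_eq_right zero_le_one]
  · have := intervalIntegral.norm_integral_le_of_norm_le_const (a := 0) (b := s) (f := θ k) (C := 1)
      fun t _ => by rw [Real.norm_eq_abs, abs_of_nonneg (h01 k t).1]; exact (h01 k t).2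
    simpa using this
  · have := intervalIntegral.tendsto_integral_filter_of_dominated_convergence (μ := volume)
      (a := 0) (b := s) (F := θ) (f := fun _ => 1) (l := atTop) (fun _ => 1)
      (Eventually.of_forall fun k => (hc k).aestronglyMeasurable)
      (Eventually.of_forall fun k => Eventually.of_forall fun t _ => by
        rw [Real.norm_eq_abs, abs_of_nonneg (h01 k t).1]; exact (h01 k t).2)
      intervalIntegrable_const (by
        have h0 : ∀ᵐ t : ℝ, t ≠ 0 := by simp [ae_iff]
        filter_upwards [h0] with t ht _
        refine tendsto_const_nhds.congr' ?_
        obtain ⟨N, hN⟩ := exists_nat_gt (2 / |t|)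
        filter_upwards [eventually_ge_atTop N] with k hk
        have ht' : 0 < |t| := abs_pos.2 ht
        have hNk : (N : ℝ) ≤ k := by exact_mod_cast hk
        have := (div_lt_iff₀ ht').1 (hN.trans_le hNk)
        simp only [hθ]
        rw [eq_comm, min_eq_left]
        exact le_max_of_le_right (by nlinarith))
    simpa using this

theorem contDiff_one_of_tsupport {E : Type*} [NormedAddCommGroup E] [NormedSpace ℝ E] {f : E → ℝ}
    (h : ∀ x ∈ tsupport f, ContDiffAt ℝ 1 f x) : ContDiff ℝ 1 f := by
  refine contDiff_iff_contDiffAt.2 fun x => ?_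
  by_cases hx : x ∈ tsupport f
  · exact h x hx
  · exact contDiffAt_const.congr_of_eventuallyEq (notMem_tsupport_iff_eventuallyEq.1 hx)

theorem contDiff_div_of_tsupport {E : Type*} [NormedAddCommGroup E] [NormedSpace ℝ E] {Ω : Set E}
    (hΩ : IsOpen Ω) {u φ : E → ℝ}
    (hu : ContDiffOn ℝ 1 u Ω) (hpos : ∀ x ∈ Ω, 0 < u x) (hφ : ContDiff ℝ 1 φ)
    (hs : tsupport φ ⊆ Ω) : ContDiff ℝ 1 fun x => φ x / u x := by
  refine contDiff_one_of_tsupport fun x hx => ?_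
  have hx' : x ∈ Ω := by
    refine hs (tsupport_mul_subset_left (f := φ) (g := fun x => (u x)⁻¹) ?_)
    simpa only [div_eq_mul_inv] using hx
  exact hφ.contDiffAt.div (hu.contDiffAt (hΩ.mem_nhds hx')) (hpos x hx').ne'

section eigenfunctions
variable {E : Type*} [NormedAddCommGroup E] [InnerProductSpace ℝ E] [FiniteDimensional ℝ E]

theorem contDiff_indicator_truncation {Ω : Set E} (hΩ : IsOpen Ω) (hb : Bornology.IsBounded Ω)
    {u : E → ℝ} (hu : ContDiffOn ℝ 1 u Ω) (huc : ContinuousOn u (closure Ω))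
    (hu0 : ∀ x ∈ frontier Ω, u x = 0) {η θ : ℝ → ℝ} (hθ : Continuous θ)
    (hη : ∀ s, HasDerivAt η (θ s) s) {ε : ℝ} (hε : 0 < ε) (h0 : ∀ s, |s| ≤ ε → η s = 0) :
    ContDiff ℝ 1 (Ω.indicator fun x => η (u x)) ∧
      HasCompactSupport (Ω.indicator fun x => η (u x)) ∧
      tsupport (Ω.indicator fun x => η (u x)) ⊆ Ω := by
  set K : Set E := closure Ω ∩ (fun x => |u x|) ⁻¹' Set.Ici ε with hKdef
  have hKc : IsClosed K := huc.abs.preimage_isClosed_of_isClosed isClosed_closure isClosed_Ici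
  have hKΩ : K ⊆ Ω := fun x hx => by
    by_contra h
    have h1 : |u x| = 0 := by rw [hu0 x (hΩ.frontier_eq ▸ ⟨hx.1, h⟩), abs_zero]
    have h2 : ε ≤ |u x| := hx.2
    linarith
  have hs : tsupport (Ω.indicator fun x => η (u x)) ⊆ K := by
    refine closure_minimal (fun x hx => ?_) hKc
    have hxΩ : x ∈ Ω := Set.mem_of_indicator_ne_zero hx
    refine ⟨subset_closure hxΩ, show ε ≤ |u x| from not_lt.1 fun h => hx ?_⟩
    rw [Set.indicator_of_mem hxΩ]
    exact h0 _ h.le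
  have hη1 : ContDiff ℝ 1 η := by
    refine contDiff_one_iff_deriv.2 ⟨fun s => (hη s).differentiableAt, ?_⟩
    rwa [show deriv η = θ from funext fun s => (hη s).deriv]
  refine ⟨contDiff_one_of_tsupport fun x hx => ?_,
    hb.isCompact_closure.of_isClosed_subset (isClosed_tsupport _) (hs.trans Set.inter_subset_left),
    hs.trans hKΩ⟩
  have hxΩ := hΩ.mem_nhds (hKΩ (hs hx))
  refine (hη1.contDiffAt.comp x (hu.contDiffAt hxΩ)).congr_of_eventuallyEq ?_
  filter_upwards [hxΩ] with y hy
  rw [Set.indicator_of_mem hy]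
  rfl

theorem gradient_comp_apply {η : ℝ → ℝ} {u : E → ℝ} {x : E} {c : ℝ} (hη : HasDerivAt η c (u x))
    (hu : DifferentiableAt ℝ u x) : gradient (fun y => η (u y)) x = c • gradient u x := by
  have := (hη.comp_hasFDerivAt x hu.hasFDerivAt).fderiv
  simp only [gradient]
  rw [show (fun y => η (u y)) = η ∘ u from rfl, this, map_smulₛₗ]
  simp

/-- Ground state substitution: the energy of `φ / u` weighted by `u²` when `-Δ u = l u`. -/
theorem integral_sq_mul_norm_gradient_div [MeasurableSpace E] [BorelSpace E]
    {Ω : Set E} (hΩ : IsOpen Ω) {u φ : E → ℝ}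
    (hu : ContDiffOn ℝ 1 u Ω) (hpos : ∀ x ∈ Ω, 0 < u x) {l : ℝ}
    (heq : ∀ φ : E → ℝ, ContDiff ℝ (⊤ : ℕ∞) φ → HasCompactSupport φ → tsupport φ ⊆ Ω →
      ∫ x in Ω, ⟪gradient u x, gradient φ x⟫ = l * ∫ x in Ω, u x * φ x)
    (hφ : ContDiff ℝ 1 φ) (hc : HasCompactSupport φ) (hs : tsupport φ ⊆ Ω) :
    ∫ x in Ω, u x ^ 2 * ‖gradient (fun y => φ y / u y) x‖ ^ 2 =
      (∫ x in Ω, ‖gradient φ x‖ ^ 2) - l * ∫ x in Ω, φ x ^ 2 := by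
  set f : E → ℝ := fun y => φ y / u y with hfdef
  have hf : ContDiff ℝ 1 f := contDiff_div_of_tsupport hΩ hu hpos hφ hs
  have hψ : ContDiff ℝ 1 fun x => φ x * f x := hφ.mul hf
  have hψs : tsupport (fun x => φ x * f x) ⊆ tsupport φ := tsupport_mul_subset_left
  have hgrad : ∀ x ∈ Ω, gradient φ x = u x • gradient f x + f x • gradient u x := fun x hx => by
    have hux := (hu.contDiffAt (hΩ.mem_nhds hx)).differentiableAt one_ne_zero
    rw [← gradient_mul_apply hux (hf.differentiable one_ne_zero x)]
    have : φ =ᶠ[nhds x] fun y => u y * f y := by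
      filter_upwards [hΩ.mem_nhds hx] with y hy
      rw [hfdef, mul_div_cancel₀ _ (hpos y hy).ne']
    simp only [gradient, this.fderiv_eq]
  have htest := weak_equation_extend hΩ hu heq hψ hc.mul_right (hψs.trans hs)
  have e1 : ∫ x in Ω, u x * (φ x * f x) = ∫ x in Ω, φ x ^ 2 :=
    setIntegral_congr_fun hΩ.measurableSet fun x hx => by
      have := (hpos x hx).ne'
      simp only [hfdef]
      field_simp
  rw [← e1, ← htest, ← integral_sub]
  · refine setIntegral_congr_fun hΩ.measurableSet fun x hx => ?_
    have hφx := hgrad x hx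
    have hfx : φ x = u x * f x := by simp only [hfdef]; rw [mul_div_cancel₀ _ (hpos x hx).ne']
    rw [gradient_mul_apply (hφ.differentiable one_ne_zero x) (hf.differentiable one_ne_zero x), hφx,
      hfx, ← real_inner_self_eq_norm_sq, ← real_inner_self_eq_norm_sq]
    simp only [inner_add_left, inner_add_right, real_inner_smul_left, real_inner_smul_right]
    rw [real_inner_comm (gradient u x) (gradient f x)]
    ring
  · refine integrableOn_of_continuousOn_of_tsupport hΩ
      ((continuous_gradient hφ).norm.pow 2).continuousOn hc.isCompact hs fun x _ hx => ?_
    simp [gradient_eq_zero_of_notMem_tsupport hx]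
  · refine integrableOn_of_continuousOn_of_tsupport hΩ ((continuousOn_gradient hΩ hu).inner
      (continuous_gradient hψ).continuousOn) hc.isCompact hs fun x _ hx => ?_
    rw [gradient_eq_zero_of_notMem_tsupport fun h => hx (hψs h), inner_zero_right]

/-- Caccioppoli-type bound for truncations of an eigenfunction. -/
theorem integral_norm_gradient_truncation_le [MeasurableSpace E] [BorelSpace E]
    {Ω : Set E} (hΩ : IsOpen Ω) {u : E → ℝ} (hu : ContDiffOn ℝ 1 u Ω) {l : ℝ}
    (heq : ∀ φ : E → ℝ, ContDiff ℝ (⊤ : ℕ∞) φ → HasCompactSupport φ → tsupport φ ⊆ Ω →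
      ∫ x in Ω, ⟪gradient u x, gradient φ x⟫ = l * ∫ x in Ω, u x * φ x)
    {η θ : ℝ → ℝ} (hη : ∀ s, HasDerivAt η (θ s) s) (hθ : ∀ s, 0 ≤ θ s ∧ θ s ≤ 1) {φ : E → ℝ}
    (hφu : ∀ x ∈ Ω, φ x = η (u x))
    (hφ : ContDiff ℝ 1 φ) (hc : HasCompactSupport φ) (hs : tsupport φ ⊆ Ω) :
    ∫ x in Ω, ‖gradient φ x‖ ^ 2 ≤ l * ∫ x in Ω, u x * φ x := by
  rw [← weak_equation_extend hΩ hu heq hφ hc hs]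
  refine setIntegral_mono_on ?_ ?_ hΩ.measurableSet fun x hx => ?_
  · refine integrableOn_of_continuousOn_of_tsupport hΩ
      ((continuous_gradient hφ).norm.pow 2).continuousOn hc.isCompact hs fun x _ hx => ?_
    simp [gradient_eq_zero_of_notMem_tsupport hx]
  · refine integrableOn_of_continuousOn_of_tsupport hΩ ((continuousOn_gradient hΩ hu).inner
      (continuous_gradient hφ).continuousOn) hc.isCompact hs fun x _ hx => ?_
    rw [gradient_eq_zero_of_notMem_tsupport hx, inner_zero_right]
  · have hux := (hu.contDiffAt (hΩ.mem_nhds hx)).differentiableAt one_ne_zero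
    have he : φ =ᶠ[nhds x] fun y => η (u y) := by
      filter_upwards [hΩ.mem_nhds hx] with y hy using hφu y hy
    have hg : gradient φ x = θ (u x) • gradient u x := by
      rw [← gradient_comp_apply (hη _) hux]
      simp only [gradient, he.fderiv_eq]
    obtain ⟨h0, h1⟩ := hθ (u x)
    rw [hg, norm_smul, real_inner_smul_right, real_inner_self_eq_norm_sq, mul_pow, Real.norm_eq_abs,
      sq_abs]
    exact mul_le_mul_of_nonneg_right (by nlinarith) (sq_nonneg _)

theorem isLogConcaveWeight_indicator_sq [MeasurableSpace E] [BorelSpace E]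
    {Ω : Set E} (hΩ : IsOpen Ω) (hb : Bornology.IsBounded Ω) {u : E → ℝ}
    (hpos : ∀ x ∈ Ω, 0 < u x) (huc : ContinuousOn u (closure Ω))
    (hlc : ConcaveOn ℝ Ω fun x => Real.log (u x)) :
    IsLogConcaveWeight (Metric.diam Ω) (Ω.indicator fun x => u x ^ 2) := by
  have hset : {x | 0 < Ω.indicator (fun x => u x ^ 2) x} = Ω := by
    ext x
    by_cases hx : x ∈ Ω
    · simpa [hx] using pow_pos (hpos x hx) 2
    · simp [hx]
  have hmem : ∀ {x}, 0 < Ω.indicator (fun x => u x ^ 2) x → x ∈ Ω := fun {x} h => by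
    rw [← hset]; exact h
  refine ⟨fun x => Set.indicator_nonneg (fun x _ => sq_nonneg _) x, ?_, ?_, ?_,
    fun x y hx hy => Metric.dist_le_diam_of_mem hb (hmem hx) (hmem hy)⟩
  · classical
    rw [← Set.piecewise_eq_indicator]
    exact ((huc.mono subset_closure).pow 2).measurable_piecewise continuousOn_const hΩ.measurableSet
  · obtain ⟨M, hM⟩ := hb.isCompact_closure.exists_bound_of_continuousOn (huc.pow 2)
    refine ⟨max M 0, fun x => ?_⟩
    by_cases hx : x ∈ Ω
    · rw [Set.indicator_of_mem hx]
      exact le_max_of_le_left ((le_abs_self _).trans (hM x (subset_closure hx)))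
    · rw [Set.indicator_of_notMem hx]
      exact le_max_right _ _
  · rw [hset]
    refine (hlc.smul (zero_le_two (α := ℝ))).congr fun x hx => ?_
    simp [Set.indicator_of_mem hx, Real.log_pow]

theorem tendsto_setIntegral_mul_truncation [MeasurableSpace E] [BorelSpace E]
    {Ω : Set E} (hΩ : IsOpen Ω) (hb : Bornology.IsBounded Ω) {w u : E → ℝ}
    (hw : ContinuousOn w (closure Ω)) (hu : ContinuousOn u (closure Ω)) {a : ℕ → E → ℝ}
    (ha : ∀ k, Continuous (a k)) (hau : ∀ k, ∀ x ∈ Ω, |a k x| ≤ |w x|) {b : E → ℝ}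
    (hlim : ∀ x ∈ Ω, Tendsto (fun k => a k x) atTop (nhds (b x))) :
    Tendsto (fun k => ∫ x in Ω, u x * a k x) atTop (nhds (∫ x in Ω, u x * b x)) := by
  refine tendsto_integral_of_dominated_convergence (fun x => |u x| * |w x|) (fun k => ?_) ?_
    (fun k => ?_) ?_
  · exact ((hu.mono subset_closure).mul (ha k).continuousOn).aestronglyMeasurable hΩ.measurableSet
  · exact ((hu.abs.mul hw.abs).integrableOn_compact hb.isCompact_closure).mono_set subset_closure
  · filter_upwards [ae_restrict_mem hΩ.measurableSet] with x hx
    rw [norm_mul]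
    exact mul_le_mul_of_nonneg_left (hau k x hx) (abs_nonneg _)
  · filter_upwards [ae_restrict_mem hΩ.measurableSet] with x hx
    exact (hlim x hx).const_mul _

/-- A log-concave Poincaré inequality on a bounded domain bounds the gap between the eigenvalues of a
positive log-concave eigenfunction and of an eigenfunction orthogonal to it. -/
theorem HasLogConcavePoincare.sq_le_sub [MeasurableSpace E] [BorelSpace E] {κ : ℝ}
    {Ω : Set E} (hP : HasLogConcavePoincare (volume : Measure E) κ (Metric.diam Ω))
    (hΩ : IsOpen Ω) (hb : Bornology.IsBounded Ω) {u v : E → ℝ} {l m : ℝ}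
    (hu : ContDiffOn ℝ 1 u Ω) (hpos : ∀ x ∈ Ω, 0 < u x) (huc : ContinuousOn u (closure Ω))
    (hueq : ∀ φ : E → ℝ, ContDiff ℝ (⊤ : ℕ∞) φ → HasCompactSupport φ → tsupport φ ⊆ Ω →
      ∫ x in Ω, ⟪gradient u x, gradient φ x⟫ = l * ∫ x in Ω, u x * φ x)
    (hlc : ConcaveOn ℝ Ω fun x => Real.log (u x)) (hunorm : ∫ x in Ω, u x ^ 2 = 1)
    (hv : ContDiffOn ℝ 1 v Ω) (hvc : ContinuousOn v (closure Ω))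
    (hv0 : ∀ x ∈ frontier Ω, v x = 0)
    (hveq : ∀ φ : E → ℝ, ContDiff ℝ (⊤ : ℕ∞) φ → HasCompactSupport φ → tsupport φ ⊆ Ω →
      ∫ x in Ω, ⟪gradient v x, gradient φ x⟫ = m * ∫ x in Ω, v x * φ x)
    (hvnorm : ∫ x in Ω, v x ^ 2 = 1) (horth : ∫ x in Ω, u x * v x = 0) : κ ^ 2 ≤ m - l := by
  obtain ⟨η, θ, hθc, hη, hθ, hη0, hηle, hηlim⟩ := exists_truncation
  set φ : ℕ → E → ℝ := fun k => Ω.indicator fun x => η k (v x) with hφdef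
  have hφv : ∀ k, ∀ x ∈ Ω, φ k x = η k (v x) := fun k x hx => Set.indicator_of_mem hx _
  have hφ : ∀ k, ContDiff ℝ 1 (φ k) ∧ HasCompactSupport (φ k) ∧ tsupport (φ k) ⊆ Ω := fun k => by
    obtain ⟨ε, hε, h0⟩ := hη0 k
    exact contDiff_indicator_truncation hΩ hb hv hvc hv0 (hθc k) (hη k) hε h0
  have key : ∀ k, κ ^ 2 * ((∫ x in Ω, 1 * φ k x ^ 2) - (∫ x in Ω, u x * φ k x) ^ 2) ≤
      m * (∫ x in Ω, v x * φ k x) - l * ∫ x in Ω, 1 * φ k x ^ 2 := fun k => by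
    obtain ⟨h1, h2, h3⟩ := hφ k
    have hf := contDiff_div_of_tsupport hΩ hu hpos h1 h3
    have hfc : HasCompactSupport fun x => φ k x / u x := by
      simp only [div_eq_mul_inv]
      exact h2.mul_right
    have hw := hP _ (isLogConcaveWeight_indicator_sq hΩ hb hpos huc hlc) _ hf hfc
    have hind : ∀ g : E → ℝ, ∫ x, Ω.indicator (fun x => u x ^ 2) x * g x =
        ∫ x in Ω, u x ^ 2 * g x := fun g => by
      rw [← integral_indicator hΩ.measurableSet]
      simp only [Set.indicator_mul_left]
    rw [hind, hind, hind, integral_indicator hΩ.measurableSet, hunorm, one_mul, one_mul] at hw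
    have e1 : ∫ x in Ω, u x ^ 2 * (φ k x / u x) ^ 2 = ∫ x in Ω, 1 * φ k x ^ 2 :=
      setIntegral_congr_fun hΩ.measurableSet fun x hx => by
        have := (hpos x hx).ne'
        field_simp
    have e2 : ∫ x in Ω, u x ^ 2 * (φ k x / u x) = ∫ x in Ω, u x * φ k x :=
      setIntegral_congr_fun hΩ.measurableSet fun x hx => by
        have := (hpos x hx).ne'
        field_simp
    have e3 := integral_sq_mul_norm_gradient_div hΩ hu hpos hueq h1 h2 h3
    have e4 := integral_norm_gradient_truncation_le hΩ hv hveq (hη k) (hθ k) (hφv k) h1 h2 h3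
    simp only [norm_gradient] at e3 e4
    rw [e1, e2, e3] at hw
    simp only [one_mul] at hw ⊢
    linarith
  have hφle : ∀ k, ∀ x ∈ Ω, |φ k x| ≤ |v x| := fun k x hx => by rw [hφv k x hx]; exact hηle k _
  have hφlim : ∀ x ∈ Ω, Tendsto (fun k => φ k x) atTop (nhds (v x)) := fun x hx => by
    simp only [hφv _ x hx]
    exact hηlim _
  have t1 := tendsto_setIntegral_mul_truncation hΩ hb hvc huc (fun k => (hφ k).1.continuous) hφle
    hφlim
  have t2 := tendsto_setIntegral_mul_truncation hΩ hb hvc hvc (fun k => (hφ k).1.continuous) hφle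
    hφlim
  have t3 := tendsto_setIntegral_mul_truncation (a := fun k x => φ k x ^ 2) (b := fun x => v x ^ 2)
    (w := fun x => v x ^ 2)
    hΩ hb (hvc.pow 2) (continuousOn_const (c := (1 : ℝ))) (fun k => (hφ k).1.continuous.pow 2)
    (fun k x hx => by
      rw [abs_pow, abs_pow]; exact pow_le_pow_left₀ (abs_nonneg _) (hφle k x hx) 2)
    (fun x hx => (hφlim x hx).pow 2)
  have hvv : ∫ x in Ω, v x * v x = 1 := by simpa only [sq] using hvnorm
  simp only [one_mul, horth, hvnorm, hvv] at t1 t2 t3 key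
  have := le_of_tendsto_of_tendsto' ((t3.sub (t1.pow 2)).const_mul (κ ^ 2))
    ((t2.const_mul m).sub (t3.const_mul l)) key
  simpa using this

end eigenfunctions

/-- Fundamental gap of the Dirichlet Laplacian in the form of Yu–Zhong and Smits:
`λ₂ - λ₁ ≥ π² / diam(Ω)²` on a bounded convex domain `Ω ⊂ ℝⁿ`.  Here `u₁` is the positive,
log-concave, `L²`-normalized first eigenfunction, and `u₂` is an `L²`-normalized second
eigenfunction (a weak solution of `-Δu₂ = λ₂ u₂` vanishing on `∂Ω`, orthogonal to `u₁` in
`L²(Ω)`, lying in the `W^{1,2}`-closure of smooth compactly supported functions). -/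
theorem fundamental_gap_laplacian
    {n : ℕ} (hn : 2 ≤ n)
    {Ω : Set (EuclideanSpace ℝ (Fin n))}
    (hΩo : IsOpen Ω) (hΩb : Bornology.IsBounded Ω) (hΩc : Convex ℝ Ω)
    (u₁ : EuclideanSpace ℝ (Fin n) → ℝ)
    (hu₁C : ContDiffOn ℝ 1 u₁ Ω)
    (hu₁pos : ∀ x ∈ Ω, 0 < u₁ x)
    (hu₁cont : ContinuousOn u₁ (closure Ω))
    (hu₁bd : ∀ x ∈ frontier Ω, u₁ x = 0)
    (hu₁eig : ∀ φ : EuclideanSpace ℝ (Fin n) → ℝ,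
      ContDiff ℝ (⊤ : ℕ∞) φ → HasCompactSupport φ → tsupport φ ⊆ Ω →
      ∫ x in Ω, ⟪gradient u₁ x, gradient φ x⟫ = lambda1 n Ω * ∫ x in Ω, u₁ x * φ x)
    (hu₁lc : ConcaveOn ℝ Ω fun x => Real.log (u₁ x))
    (hu₁norm : ∫ x in Ω, (u₁ x) ^ 2 = 1)
    (lam2 : ℝ) (hgap : lambda1 n Ω < lam2)
    (u₂ : EuclideanSpace ℝ (Fin n) → ℝ)
    (hu₂C : ContDiffOn ℝ 1 u₂ Ω)
    (hu₂cont : ContinuousOn u₂ (closure Ω))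
    (hu₂bd : ∀ x ∈ frontier Ω, u₂ x = 0)
    (hu₂eig : ∀ φ : EuclideanSpace ℝ (Fin n) → ℝ,
      ContDiff ℝ (⊤ : ℕ∞) φ → HasCompactSupport φ → tsupport φ ⊆ Ω →
      ∫ x in Ω, ⟪gradient u₂ x, gradient φ x⟫ = lam2 * ∫ x in Ω, u₂ x * φ x)
    (hu₂norm : ∫ x in Ω, (u₂ x) ^ 2 = 1)
    (horth : ∫ x in Ω, u₁ x * u₂ x = 0)
    (hu₂dens : ∃ φ : ℕ → (EuclideanSpace ℝ (Fin n) → ℝ),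
      (∀ k, ContDiff ℝ (⊤ : ℕ∞) (φ k) ∧ HasCompactSupport (φ k) ∧ tsupport (φ k) ⊆ Ω) ∧
      Tendsto (fun k => ∫ x in Ω, ‖gradient (φ k) x - gradient u₂ x‖ ^ 2) atTop (nhds 0) ∧
      Tendsto (fun k => ∫ x in Ω, |φ k x - u₂ x| ^ 2) atTop (nhds 0)) :
    lam2 - lambda1 n Ω ≥ Real.pi ^ 2 / Metric.diam Ω ^ 2 := by
  rcases (Metric.diam_nonneg (s := Ω)).eq_or_lt with hD | hD
  · rw [← hD]
    simpa using hgap.le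
  have hfin : Module.finrank ℝ (EuclideanSpace ℝ (Fin n)) = n - 1 + 1 := by
    rw [finrank_euclideanSpace_fin]
    omega
  have hκ : ∀ κ ∈ Set.Ioo 0 (π / Metric.diam Ω), κ ^ 2 ≤ lam2 - lambda1 n Ω := fun κ hκ =>
    (hasLogConcavePoincare_of_finrank hκ.1 ((lt_div_iff₀ hD).1 hκ.2) (n - 1) _ hfin).sq_le_sub
      hΩo hΩb hu₁C hu₁pos hu₁cont hu₁eig hu₁lc hu₁norm hu₂C hu₂cont hu₂bd hu₂eig hu₂norm horth
  have hpos : 0 < π / Metric.diam Ω := div_pos pi_pos hD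
  have hlim : Tendsto (fun κ : ℝ => κ ^ 2) (nhdsWithin (π / Metric.diam Ω) (Set.Iio (π / Metric.diam Ω)))
      (nhds ((π / Metric.diam Ω) ^ 2)) :=
    ((continuous_pow 2).tendsto _).mono_left nhdsWithin_le_nhds
  rw [ge_iff_le, ← div_pow]
  exact le_of_tendsto hlim (mem_of_superset (Ioo_mem_nhdsLT hpos) hκ)
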